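/- Assume either β ∈ (ϖ1, 0) in Case [N1], or β ∈ (ϖ1, ϖ2] in Case [N2] with ρ > Υ. Then for every positive solution u of equation (E) in Ω∖{0} there exists a ∈ (0,∞) such that |x|^{ϖ1} u(x) → a and |x|^{ϖ1} (x·∇u(x)) → −a ϖ1 as |x| → 0. -/

import Mathlib

open MeasureTheory Filter Topology Real RealInnerProductSpace

noncomputable section

/-- The gradient factor `G_τ(x,z,ξ) = z^τ ‖ξ‖^(1-τ) / ‖x‖^(τ+1)`.
For `τ = 0` this equals `‖ξ‖ / ‖x‖`, since `z ^ (0:ℝ) = 1` for real powers. -/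
def Gt {N : ℕ} (τ : ℝ) (x : EuclideanSpace ℝ (Fin N)) (z : ℝ)
    (ξ : EuclideanSpace ℝ (Fin N)) : ℝ :=
  z ^ τ * ‖ξ‖ ^ (1 - τ) / ‖x‖ ^ (τ + 1)

/-- Test functions: `C¹` functions with compact support contained in `Ω \ {0}`. -/
def IsTestFun {N : ℕ} (Ω : Set (EuclideanSpace ℝ (Fin N)))
    (φ : EuclideanSpace ℝ (Fin N) → ℝ) : Prop :=
  ContDiff ℝ 1 φ ∧ HasCompactSupport φ ∧ tsupport φ ⊆ Ω \ {0}

/-- The distributional pairing of equation (E) with a test function `φ`: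
`∫ ∇u·∇φ + (N-2+2ρ) ∫ ((x·∇u)/|x|²) φ - λ ∫ G_τ(x,u,∇u) φ + ∫ |x|^θ u^q φ`. -/
def weakE (N : ℕ) (ρ lam τ θ q : ℝ) (Ω : Set (EuclideanSpace ℝ (Fin N)))
    (u φ : EuclideanSpace ℝ (Fin N) → ℝ) : ℝ :=
  (∫ x in Ω \ {0}, ⟪gradient u x, gradient φ x⟫)
    + ((N : ℝ) - 2 + 2 * ρ) * (∫ x in Ω \ {0}, ⟪x, gradient u x⟫ / ‖x‖ ^ 2 * φ x)
    - lam * (∫ x in Ω \ {0}, Gt τ x (u x) (gradient u x) * φ x)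
    + ∫ x in Ω \ {0}, ‖x‖ ^ θ * u x ^ q * φ x

/-- A positive `C¹` function on `Ω \ {0}`. -/
def PosC1 {N : ℕ} (Ω : Set (EuclideanSpace ℝ (Fin N)))
    (u : EuclideanSpace ℝ (Fin N) → ℝ) : Prop :=
  ContDiffOn ℝ 1 u (Ω \ {0}) ∧ ∀ x ∈ Ω \ {0}, 0 < u x

/-- Positive distributional solution of equation (E) in `Ω \ {0}`. -/
def IsSolutionE (N : ℕ) (ρ lam τ θ q : ℝ) (Ω : Set (EuclideanSpace ℝ (Fin N)))
    (u : EuclideanSpace ℝ (Fin N) → ℝ) : Prop :=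
  PosC1 Ω u ∧ ∀ φ, IsTestFun Ω φ → weakE N ρ lam τ θ q Ω u φ = 0

/-- Positive sub-solution of equation (E) in `Ω \ {0}`. -/
def IsSubSolutionE (N : ℕ) (ρ lam τ θ q : ℝ) (Ω : Set (EuclideanSpace ℝ (Fin N)))
    (u : EuclideanSpace ℝ (Fin N) → ℝ) : Prop :=
  PosC1 Ω u ∧ ∀ φ, IsTestFun Ω φ → (∀ x, 0 ≤ φ x) → weakE N ρ lam τ θ q Ω u φ ≤ 0

/-- Positive super-solution of equation (E) in `Ω \ {0}`. -/
def IsSuperSolutionE (N : ℕ) (ρ lam τ θ q : ℝ) (Ω : Set (EuclideanSpace ℝ (Fin N)))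
    (u : EuclideanSpace ℝ (Fin N) → ℝ) : Prop :=
  PosC1 Ω u ∧ ∀ φ, IsTestFun Ω φ → (∀ x, 0 ≤ φ x) → 0 ≤ weakE N ρ lam τ θ q Ω u φ

/-- `f_ρ(t) = t (t + 2ρ) + λ |t|^(1-τ)`. -/
def fRho (ρ lam τ t : ℝ) : ℝ := t * (t + 2 * ρ) + lam * |t| ^ (1 - τ)

/-- `Υ = ((τ+1)/(2τ)) (λτ)^(1/(τ+1))`. -/
def Upsilon (lam τ : ℝ) : ℝ := ((τ + 1) / (2 * τ)) * (lam * τ) ^ (1 / (τ + 1))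

/-- Case [N₀]: (a) `τ = 0` and `λ ≥ 2ρ`, or (b) `λ > 0`, `τ ∈ (0,1)` and `ρ < Υ`. -/
def CaseN0 (ρ lam τ : ℝ) : Prop :=
  (τ = 0 ∧ 2 * ρ ≤ lam) ∨ (0 < lam ∧ 0 < τ ∧ τ < 1 ∧ ρ < Upsilon lam τ)

/-- Case [N₁]: (a) `τ = 0` and `λ < 2ρ`, or (b) `λ < 0` and `τ ∈ (0,1)`. -/
def CaseN1 (ρ lam τ : ℝ) : Prop :=
  (τ = 0 ∧ lam < 2 * ρ) ∨ (lam < 0 ∧ 0 < τ ∧ τ < 1)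

/-- Case [N₂]: `λ > 0`, `τ ∈ (0,1)` and `ρ ≥ Υ`. -/
def CaseN2 (ρ lam τ : ℝ) : Prop :=
  0 < lam ∧ 0 < τ ∧ τ < 1 ∧ Upsilon lam τ ≤ ρ

/-- `w` is the smallest negative root of `f_ρ` (i.e. `w = ϖ₁`). -/
def IsMinNegRoot (ρ lam τ w : ℝ) : Prop :=
  w < 0 ∧ fRho ρ lam τ w = 0 ∧ ∀ t, t < 0 → fRho ρ lam τ t = 0 → w ≤ t

/-- `w` is the largest negative root of `f_ρ` (i.e. `w = ϖ₂`). -/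
def IsMaxNegRoot (ρ lam τ w : ℝ) : Prop :=
  w < 0 ∧ fRho ρ lam τ w = 0 ∧ ∀ t, t < 0 → fRho ρ lam τ t = 0 → t ≤ w

/-- `Φ_{ϖ₂}(r)`: equal to `r^(-ϖ₂)` if `ρ > Υ` and to `r^(-ϖ₂) |log r|^(2/(1+τ))` if `ρ = Υ`. -/
def Phi2 (ρ lam τ w2 r : ℝ) : ℝ :=
  if ρ = Upsilon lam τ then r ^ (-w2) * |Real.log r| ^ (2 / (1 + τ)) else r ^ (-w2)

/-- `Ψ_{ϖ₁}(t)`: equal to `t^(-ϖ₁)` if `ρ > Υ` and to `t^(-ϖ₁) (log t)^(2/(1+τ))` if `ρ = Υ`. -/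
def Psi1 (ρ lam τ w1 t : ℝ) : ℝ :=
  if ρ = Upsilon lam τ then t ^ (-w1) * (Real.log t) ^ (2 / (1 + τ)) else t ^ (-w1)

/-- The radial operator `L_{ρ,λ,τ}[P](r) = P'' + (1-2ρ) P'/r + λ P^τ |P'|^(1-τ)/r^(1+τ)`. -/
def Lrad (ρ lam τ : ℝ) (P : ℝ → ℝ) (r : ℝ) : ℝ :=
  deriv (deriv P) r + (1 - 2 * ρ) * deriv P r / r
    + lam * P r ^ τ * |deriv P r| ^ (1 - τ) / r ^ (1 + τ)

/-- The Laplacian of `u` at `x`, as the trace of the second derivative. -/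
def lapl {N : ℕ} (u : EuclideanSpace ℝ (Fin N) → ℝ) (x : EuclideanSpace ℝ (Fin N)) : ℝ :=
  ∑ i : Fin N, iteratedFDeriv ℝ 2 u x ![EuclideanSpace.single i 1, EuclideanSpace.single i 1]

/-! ### Weak solutions of Poisson's equation -/

/-- A test function on `U`: a `C¹` function with compact support contained in `U`. -/
def IsTestOn {N : ℕ} (U : Set (EuclideanSpace ℝ (Fin N)))
    (ψ : EuclideanSpace ℝ (Fin N) → ℝ) : Prop :=
  ContDiff ℝ 1 ψ ∧ HasCompactSupport ψ ∧ tsupport ψ ⊆ U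

/-- `u` is `C¹` on `U` with gradient `p`, and `Δu = g` holds weakly on `U`. -/
structure WeakPoisson {N : ℕ} (U : Set (EuclideanSpace ℝ (Fin N)))
    (u : EuclideanSpace ℝ (Fin N) → ℝ)
    (p : EuclideanSpace ℝ (Fin N) → EuclideanSpace ℝ (Fin N))
    (g : EuclideanSpace ℝ (Fin N) → ℝ) : Prop where
  grad : ∀ x ∈ U, HasGradientAt u (p x) x
  cont_grad : ContinuousOn p U
  cont_rhs : ContinuousOn g U
  weak : ∀ ψ, IsTestOn U ψ → ∫ x, (⟪p x, gradient ψ x⟫ + g x * ψ x) = 0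

/-- `φ` is `C²` on `s`, with gradient `P` and Hessian `D`. -/
structure HasHessianOn {N : ℕ} (s : Set (EuclideanSpace ℝ (Fin N)))
    (φ : EuclideanSpace ℝ (Fin N) → ℝ)
    (P : EuclideanSpace ℝ (Fin N) → EuclideanSpace ℝ (Fin N))
    (D : EuclideanSpace ℝ (Fin N) → EuclideanSpace ℝ (Fin N) →L[ℝ] EuclideanSpace ℝ (Fin N)) :
    Prop where
  grad : ∀ x ∈ s, HasGradientAt φ (P x) x
  hess : ∀ x ∈ s, HasFDerivAt P (D x) x
  cont : ContinuousOn D s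

/-- The trace of an endomorphism of Euclidean space. -/
def euclTrace {N : ℕ} (D : EuclideanSpace ℝ (Fin N) →L[ℝ] EuclideanSpace ℝ (Fin N)) : ℝ :=
  ∑ i, ⟪EuclideanSpace.basisFun (Fin N) ℝ i, D (EuclideanSpace.basisFun (Fin N) ℝ i)⟫

section Basic

variable {N : ℕ} {U s : Set (EuclideanSpace ℝ (Fin N))}
  {u v g h φ φ₂ ψ : EuclideanSpace ℝ (Fin N) → ℝ}
  {p r P P₂ : EuclideanSpace ℝ (Fin N) → EuclideanSpace ℝ (Fin N)}
  {D D₂ : EuclideanSpace ℝ (Fin N) → EuclideanSpace ℝ (Fin N) →L[ℝ] EuclideanSpace ℝ (Fin N)}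

lemma continuous_gradient_of_contDiff (hψ : ContDiff ℝ 1 ψ) : Continuous (gradient ψ) := by
  have := hψ.continuous_fderiv (by norm_num)
  exact (InnerProductSpace.toDual ℝ (EuclideanSpace ℝ (Fin N))).symm.continuous.comp this

lemma gradient_eq_zero_of_notMem_tsupport {x : EuclideanSpace ℝ (Fin N)}
    (hx : x ∉ tsupport ψ) : gradient ψ x = 0 := by
  have : fderiv ℝ ψ x = 0 := fderiv_of_notMem_tsupport ℝ hx
  simp [gradient, this]

/-- A product of a function continuous on `U` with a compactly supported one is integrable. -/
lemma integrable_of_eq_zero_off_tsupport (hψ : HasCompactSupport ψ) (hsub : tsupport ψ ⊆ U)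
    (hU : IsOpen U) (hcont : ContinuousOn h U) (hzero : ∀ x, x ∉ tsupport ψ → h x = 0) :
    Integrable h := by
  have hsupp : tsupport h ⊆ tsupport ψ := by
    refine closure_minimal (fun x hx => ?_) (isClosed_tsupport ψ)
    by_contra hn
    exact hx (hzero x hn)
  refine Continuous.integrable_of_hasCompactSupport ?_
    (hψ.of_isClosed_subset (isClosed_tsupport h) hsupp)
  exact continuous_of_tsupport fun x hx =>
    hcont.continuousAt (hU.mem_nhds (hsub (hsupp hx)))

lemma IsTestOn.integrable_mul (hψ : IsTestOn U ψ) (hU : IsOpen U) (hg : ContinuousOn g U) :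
    Integrable (fun x => g x * ψ x) := by
  refine integrable_of_eq_zero_off_tsupport hψ.2.1 hψ.2.2 hU
    (hg.mul hψ.1.continuous.continuousOn) fun x hx => ?_
  simp [image_eq_zero_of_notMem_tsupport hx]

lemma IsTestOn.integrable_inner (hψ : IsTestOn U ψ) (hU : IsOpen U) (hp : ContinuousOn p U) :
    Integrable (fun x => ⟪p x, gradient ψ x⟫) := by
  refine integrable_of_eq_zero_off_tsupport hψ.2.1 hψ.2.2 hU
    (hp.inner (continuous_gradient_of_contDiff hψ.1).continuousOn) fun x hx => ?_
  simp [gradient_eq_zero_of_notMem_tsupport hx]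

lemma IsTestOn.mono {V : Set (EuclideanSpace ℝ (Fin N))} (hψ : IsTestOn V ψ) (h : V ⊆ U) :
    IsTestOn U ψ := ⟨hψ.1, hψ.2.1, hψ.2.2.trans h⟩

lemma WeakPoisson.mono {V : Set (EuclideanSpace ℝ (Fin N))} (hu : WeakPoisson U u p g)
    (h : V ⊆ U) : WeakPoisson V u p g :=
  ⟨fun x hx => hu.grad x (h hx), hu.cont_grad.mono h, hu.cont_rhs.mono h,
    fun ψ hψ => hu.weak ψ (hψ.mono h)⟩

lemma WeakPoisson.continuousOn (hu : WeakPoisson U u p g) : ContinuousOn u U :=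
  fun x hx => (hu.grad x hx).continuousAt.continuousWithinAt

lemma HasGradientAt.sub_fun {a b x : EuclideanSpace ℝ (Fin N)} (hu : HasGradientAt u a x)
    (hv : HasGradientAt v b x) : HasGradientAt (fun y => u y - v y) (a - b) x := by
  rw [hasGradientAt_iff_hasFDerivAt] at *
  rw [map_sub]
  exact hu.sub hv

lemma HasGradientAt.add_fun {a b x : EuclideanSpace ℝ (Fin N)} (hu : HasGradientAt u a x)
    (hv : HasGradientAt v b x) : HasGradientAt (fun y => u y + v y) (a + b) x := by
  rw [hasGradientAt_iff_hasFDerivAt] at *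
  rw [map_add]
  exact hu.add hv

lemma HasGradientAt.comp_real {f : ℝ → ℝ} {f' : ℝ} {a x : EuclideanSpace ℝ (Fin N)}
    (hu : HasGradientAt u a x) (hf : HasDerivAt f f' (u x)) :
    HasGradientAt (fun y => f (u y)) (f' • a) x := by
  rw [hasGradientAt_iff_hasFDerivAt] at *
  rw [map_smul]
  exact hf.comp_hasFDerivAt x hu

lemma WeakPoisson.sub (hU : IsOpen U) (hu : WeakPoisson U u p g) (hv : WeakPoisson U v r h) :
    WeakPoisson U (fun x => u x - v x) (fun x => p x - r x) (fun x => g x - h x) := by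
  refine ⟨fun x hx => (hu.grad x hx).sub_fun (hv.grad x hx), hu.cont_grad.sub hv.cont_grad,
    hu.cont_rhs.sub hv.cont_rhs, fun ψ hψ => ?_⟩
  have h1 := hu.weak ψ hψ
  have h2 := hv.weak ψ hψ
  have i1 := (hψ.integrable_inner hU hu.cont_grad).add (hψ.integrable_mul hU hu.cont_rhs)
  have i2 := (hψ.integrable_inner hU hv.cont_grad).add (hψ.integrable_mul hU hv.cont_rhs)
  have := integral_sub i1 i2
  simp only [Pi.add_apply] at this
  rw [h1, h2, sub_zero] at this
  rw [← this]
  congr 1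
  ext x
  rw [inner_sub_left]
  ring

lemma WeakPoisson.neg (hu : WeakPoisson U u p g) :
    WeakPoisson U (fun x => -u x) (fun x => -p x) (fun x => -g x) := by
  refine ⟨fun x hx => ?_, hu.cont_grad.neg, hu.cont_rhs.neg, fun ψ hψ => ?_⟩
  · have := (hu.grad x hx).comp_real (f := fun t => -t) (hasDerivAt_neg (u x))
    simpa using this
  · have h1 := hu.weak ψ hψ
    rw [← neg_eq_zero, ← integral_neg] at h1
    rw [← h1]
    congr 1
    ext x
    rw [inner_neg_left]
    ring

/-- The composition of a weak solution with a linear isometry. -/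
lemma WeakPoisson.comp_isometry (hu : WeakPoisson U u p g)
    (σ : EuclideanSpace ℝ (Fin N) ≃ₗᵢ[ℝ] EuclideanSpace ℝ (Fin N)) :
    WeakPoisson (σ ⁻¹' U) (fun x => u (σ x)) (fun x => σ.symm (p (σ x))) (fun x => g (σ x)) := by
  have key : ∀ {w : EuclideanSpace ℝ (Fin N) → ℝ} {a x : EuclideanSpace ℝ (Fin N)}
      (σ : EuclideanSpace ℝ (Fin N) ≃ₗᵢ[ℝ] EuclideanSpace ℝ (Fin N)),
      HasGradientAt w a (σ x) → HasGradientAt (fun y => w (σ y)) (σ.symm a) x := by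
    intro w a x σ hw
    rw [hasGradientAt_iff_hasFDerivAt] at *
    have h1 := hw.comp x (σ.toContinuousLinearEquiv : EuclideanSpace ℝ (Fin N) →L[ℝ]
      EuclideanSpace ℝ (Fin N)).hasFDerivAt
    convert! h1 using 1
    ext y
    simp only [InnerProductSpace.toDual_apply_apply, ContinuousLinearMap.comp_apply]
    conv_lhs => rw [← σ.inner_map_map]
    simp
  refine ⟨fun x hx => key σ (hu.grad (σ x) hx), ?_, ?_, fun ψ hψ => ?_⟩
  · exact σ.symm.continuous.comp_continuousOn
      (hu.cont_grad.comp σ.continuous.continuousOn fun x hx => hx)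
  · exact hu.cont_rhs.comp σ.continuous.continuousOn fun x hx => hx
  · have hts : tsupport (fun x => ψ (σ.symm x)) = σ '' tsupport ψ := by
      have := tsupport_comp_eq_preimage ψ σ.symm.toHomeomorph
      rw [show (fun x => ψ (σ.symm x)) = ψ ∘ σ.symm.toHomeomorph from rfl, this]
      ext x
      simp only [Set.mem_preimage, Set.mem_image]
      constructor
      · intro hx; exact ⟨σ.symm x, hx, by simp⟩
      · rintro ⟨y, hy, rfl⟩; simpa using hy
    have htest : IsTestOn U (fun x => ψ (σ.symm x)) := by
      refine ⟨hψ.1.comp σ.symm.contDiff, ?_, ?_⟩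
      · rw [HasCompactSupport, hts]
        exact IsCompact.image hψ.2.1 σ.continuous
      · rw [hts]
        rintro _ ⟨y, hy, rfl⟩
        exact hψ.2.2 hy
    have h1 := hu.weak _ htest
    rw [← σ.measurePreserving.integral_comp σ.toHomeomorph.measurableEmbedding] at h1
    rw [← h1]
    congr 1
    ext x
    have hg : gradient (fun x => ψ (σ.symm x)) (σ x) = σ (gradient ψ x) := by
      have h2 : HasGradientAt ψ (gradient ψ x) (σ.symm (σ x)) := by
        rw [σ.symm_apply_apply]
        exact ((hψ.1.differentiable (by norm_num)) x).hasGradientAt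
      have := key σ.symm h2
      simpa using this.gradient
    rw [hg, σ.symm_apply_apply]
    congr 1
    conv_lhs => rw [← σ.inner_map_map]
    simp

lemma HasHessianOn.continuousOn_grad (hφ : HasHessianOn s φ P D) : ContinuousOn P s :=
  fun x hx => (hφ.hess x hx).continuousAt.continuousWithinAt

lemma continuous_euclTrace : Continuous (euclTrace (N := N)) := by
  unfold euclTrace
  fun_prop

/-- A `C²` function is a weak solution of Poisson's equation with its own Laplacian. -/
lemma HasHessianOn.weakPoisson (hs : IsOpen s) (hφ : HasHessianOn s φ P D) :
    WeakPoisson s φ P (fun x => euclTrace (D x)) := by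
  refine ⟨hφ.grad, hφ.continuousOn_grad, continuous_euclTrace.comp_continuousOn hφ.cont,
    fun ψ hψ => ?_⟩
  set b := EuclideanSpace.basisFun (Fin N) ℝ with hb
  have hP := hφ.continuousOn_grad
  have c1 : ∀ i, ContinuousOn (fun x => ⟪b i, P x⟫) s := fun i => continuousOn_const.inner hP
  have c2 : ∀ i, ContinuousOn (fun x => ⟪b i, D x (b i)⟫) s := fun i =>
    continuousOn_const.inner (hφ.cont.clm_apply continuousOn_const)
  have hψd : Differentiable ℝ ψ := hψ.1.differentiable (by norm_num)
  have i1 : ∀ i, Integrable (fun x => ⟪b i, P x⟫ * fderiv ℝ ψ x (b i)) := fun i => by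
    refine integrable_of_eq_zero_off_tsupport hψ.2.1 hψ.2.2 hs ((c1 i).mul ?_) fun x hx => ?_
    · exact ((hψ.1.continuous_fderiv (by norm_num)).clm_apply continuous_const).continuousOn
    · simp [fderiv_of_notMem_tsupport ℝ hx]
  have i2 : ∀ i, Integrable (fun x => ⟪b i, D x (b i)⟫ * ψ x) := fun i =>
    hψ.integrable_mul hs (c2 i)
  have hpart : ∀ i, ∫ x, (⟪b i, P x⟫ * fderiv ℝ ψ x (b i) + ⟪b i, D x (b i)⟫ * ψ x) = 0 := by
    intro i
    have hder : ∀ x ∈ tsupport ψ, HasFDerivAt (fun y => ⟪b i, P y⟫)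
        ((innerSL ℝ (b i)).comp (D x)) x := fun x hx =>
      (innerSL ℝ (b i)).hasFDerivAt.comp x (hφ.hess x (hψ.2.2 hx))
    have := integral_bilinear_hasFDerivAt_right_eq_neg_left_of_integrable
      (μ := (volume : Measure (EuclideanSpace ℝ (Fin N))))
      (f := fun y => ⟪b i, P y⟫) (f' := fun x => (innerSL ℝ (b i)).comp (D x))
      (g := ψ) (g' := fderiv ℝ ψ) (v := b i) (B := ContinuousLinearMap.mul ℝ ℝ)
      (by simpa using i2 i) (by simpa using i1 i) (by simpa using hψ.integrable_mul hs (c1 i))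
      hder (fun x _ => (hψd x).hasFDerivAt)
    simp only [ContinuousLinearMap.mul_apply', ContinuousLinearMap.comp_apply,
      innerSL_apply_apply] at this
    rw [integral_add (i1 i) (i2 i), this]
    ring
  have hsum : ∀ x, ⟪P x, gradient ψ x⟫ + euclTrace (D x) * ψ x
      = ∑ i, (⟪b i, P x⟫ * fderiv ℝ ψ x (b i) + ⟪b i, D x (b i)⟫ * ψ x) := by
    intro x
    rw [Finset.sum_add_distrib, ← Finset.sum_mul, euclTrace]
    congr 1
    rw [← b.sum_inner_mul_inner (P x) (gradient ψ x)]
    refine Finset.sum_congr rfl fun i _ => ?_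
    rw [real_inner_comm, inner_gradient_right]
    simp
  simp_rw [hsum]
  rw [integral_finsetSum _ (f := fun i x => ⟪b i, P x⟫ * fderiv ℝ ψ x (b i) + ⟪b i, D x (b i)⟫ * ψ x)
    (fun i _ => (i1 i).add (i2 i))]
  exact Finset.sum_eq_zero fun i _ => hpart i

end Basic

section Touching

variable {N : ℕ} {U s : Set (EuclideanSpace ℝ (Fin N))}
  {u v g h φ φ₂ ψ : EuclideanSpace ℝ (Fin N) → ℝ}
  {p r P P₂ : EuclideanSpace ℝ (Fin N) → EuclideanSpace ℝ (Fin N)}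
  {D D₂ : EuclideanSpace ℝ (Fin N) → EuclideanSpace ℝ (Fin N) →L[ℝ] EuclideanSpace ℝ (Fin N)}

lemma euclTrace_add (A B : EuclideanSpace ℝ (Fin N) →L[ℝ] EuclideanSpace ℝ (Fin N)) :
    euclTrace (A + B) = euclTrace A + euclTrace B := by
  simp [euclTrace, inner_add_right, Finset.sum_add_distrib]

lemma euclTrace_smul (c : ℝ) (A : EuclideanSpace ℝ (Fin N) →L[ℝ] EuclideanSpace ℝ (Fin N)) :
    euclTrace (c • A) = c * euclTrace A := by
  simp [euclTrace, inner_smul_right, Finset.mul_sum]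

lemma euclTrace_zero : euclTrace (N := N) 0 = 0 := by
  simp [euclTrace]

lemma euclTrace_id : euclTrace (ContinuousLinearMap.id ℝ (EuclideanSpace ℝ (Fin N))) = N := by
  simp [euclTrace]

lemma euclTrace_smulRight (a : EuclideanSpace ℝ (Fin N)) :
    euclTrace ((innerSL ℝ a).smulRight a) = ‖a‖ ^ 2 := by
  have := (EuclideanSpace.basisFun (Fin N) ℝ).sum_inner_mul_inner a a
  rw [real_inner_self_eq_norm_sq] at this
  rw [← this, euclTrace]
  refine Finset.sum_congr rfl fun i _ => ?_
  rw [ContinuousLinearMap.smulRight_apply, inner_smul_right, innerSL_apply_apply]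

lemma HasHessianOn.add (hφ : HasHessianOn s φ P D) (hφ₂ : HasHessianOn s φ₂ P₂ D₂) :
    HasHessianOn s (fun x => φ x + φ₂ x) (fun x => P x + P₂ x) (fun x => D x + D₂ x) :=
  ⟨fun x hx => (hφ.grad x hx).add_fun (hφ₂.grad x hx),
    fun x hx => (hφ.hess x hx).add (hφ₂.hess x hx), hφ.cont.add hφ₂.cont⟩

/-- The gradient and the Hessian of the composition with a function of one real variable. -/
lemma HasHessianOn.comp_real (hφ : HasHessianOn s φ P D) {f f' f'' : ℝ → ℝ}
    (hf : ∀ x ∈ s, HasDerivAt f (f' (φ x)) (φ x))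
    (hf' : ∀ x ∈ s, HasDerivAt f' (f'' (φ x)) (φ x))
    (hf'' : ContinuousOn (fun x => f'' (φ x)) s) :
    HasHessianOn s (fun x => f (φ x)) (fun x => f' (φ x) • P x)
      (fun x => f' (φ x) • D x + f'' (φ x) • (innerSL ℝ (P x)).smulRight (P x)) := by
  have hφc : ContinuousOn φ s := fun x hx => (hφ.grad x hx).continuousAt.continuousWithinAt
  refine ⟨fun x hx => (hφ.grad x hx).comp_real (hf x hx), fun x hx => ?_, ?_⟩
  · have h1 : HasFDerivAt (fun y => f' (φ y)) (f'' (φ x) • innerSL ℝ (P x)) x :=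
      (hf' x hx).comp_hasFDerivAt x (hφ.grad x hx).hasFDerivAt
    have := h1.smul (hφ.hess x hx)
    convert! this using 1
    ext1 v
    simp [smul_smul]
  · have hf'c : ContinuousOn (fun x => f' (φ x)) s := fun x hx =>
      (ContinuousAt.comp (f := φ) (hf' x hx).continuousAt
        (hφ.grad x hx).continuousAt).continuousWithinAt
    refine (hf'c.smul hφ.cont).add (hf''.smul ?_)
    have hP := hφ.continuousOn_grad
    have : (fun x => (innerSL ℝ (P x)).smulRight (P x)) =
        fun x => ContinuousLinearMap.smulRightL ℝ _ _ (innerSL ℝ (P x)) (P x) := rfl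
    rw [this]
    exact ((ContinuousLinearMap.smulRightL ℝ (EuclideanSpace ℝ (Fin N))
      (EuclideanSpace ℝ (Fin N))).continuous.comp_continuousOn
        ((innerSL ℝ).continuous.comp_continuousOn hP)).clm_apply hP

lemma HasHessianOn.const_mul (hφ : HasHessianOn s φ P D) (c : ℝ) :
    HasHessianOn s (fun x => c * φ x) (fun x => c • P x) (fun x => c • D x) := by
  have := hφ.comp_real (f := fun t => c * t) (f' := fun _ => c) (f'' := fun _ => 0)
    (fun x _ => by simpa using (hasDerivAt_id (φ x)).const_mul c)
    (fun x _ => hasDerivAt_const _ _) continuousOn_const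
  simpa using this

lemma hasHessianOn_norm_sub_sq (z : EuclideanSpace ℝ (Fin N)) :
    HasHessianOn s (fun x => ‖x - z‖ ^ 2) (fun x => (2 : ℝ) • (x - z))
      (fun _ => (2 : ℝ) • ContinuousLinearMap.id ℝ _) := by
  refine ⟨fun x _ => ?_, fun x _ => ?_, continuousOn_const⟩
  · rw [hasGradientAt_iff_hasFDerivAt]
    have h1 := ((hasFDerivAt_id x).sub_const z).norm_sq
    convert! h1 using 1
    ext y
    simp [two_smul]
  · exact ((hasFDerivAt_id x).sub_const z).const_smul (2 : ℝ)

lemma hasHessianOn_inner (e : EuclideanSpace ℝ (Fin N)) :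
    HasHessianOn s (fun x => ⟪e, x⟫) (fun _ => e) (fun _ => 0) := by
  refine ⟨fun x _ => ?_, fun x _ => hasFDerivAt_const _ _, continuousOn_const⟩
  rw [hasGradientAt_iff_hasFDerivAt]
  exact (innerSL ℝ e).hasFDerivAt

/-- A function whose weak Laplacian is positive has no strict interior maximum. -/
lemma WeakPoisson.not_strict_max {x₀ : EuclideanSpace ℝ (Fin N)} {R ε : ℝ} (hR : 0 < R)
    (hε : 0 < ε) (hh : WeakPoisson (Metric.ball x₀ R) h p g)
    (hmax : ∀ x ∈ Metric.ball x₀ R, h x + ε * ‖x - x₀‖ ^ 2 ≤ h x₀)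
    (hg : ∀ x ∈ Metric.ball x₀ R, 0 < g x) : False := by
  classical
  set B := Metric.ball x₀ R with hB
  have hBo : IsOpen B := Metric.isOpen_ball
  set k := h x₀ - ε * (R / 2) ^ 2 with hk
  have hT : ContDiff ℝ 1 expNegInvGlue := expNegInvGlue.contDiff (n := 1)
  have hTd : ∀ t, HasDerivAt expNegInvGlue (deriv expNegInvGlue t) t := fun t =>
    (hT.differentiable (by norm_num) t).hasDerivAt
  have hTc : Continuous (deriv expNegInvGlue) := hT.continuous_deriv (by norm_num)
  set ψ : EuclideanSpace ℝ (Fin N) → ℝ := fun x =>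
    if x ∈ B then expNegInvGlue (h x - k) else 0 with hψ
  set Q : EuclideanSpace ℝ (Fin N) → EuclideanSpace ℝ (Fin N) := fun x =>
    if x ∈ B then deriv expNegInvGlue (h x - k) • p x else 0 with hQ
  have hψB : ∀ x ∈ B, ψ =ᶠ[𝓝 x] fun y => expNegInvGlue (h y - k) := fun x hx => by
    filter_upwards [hBo.mem_nhds hx] with y hy
    simp [hψ, hy]
  have hQB : ∀ x ∈ B, Q =ᶠ[𝓝 x] fun y => deriv expNegInvGlue (h y - k) • p y := fun x hx => by
    filter_upwards [hBo.mem_nhds hx] with y hy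
    simp [hQ, hy]
  have hfar : ∀ x ∈ B, R / 2 < ‖x - x₀‖ → h x - k ≤ 0 := fun x hx hxR => by
    have := hmax x hx
    have h2 : (R / 2) ^ 2 ≤ ‖x - x₀‖ ^ 2 := by gcongr
    nlinarith
  have hTz : ∀ t ≤ 0, deriv expNegInvGlue t = 0 := by
    intro t ht
    have h1 : IsLocalMin expNegInvGlue t := by
      refine Filter.Eventually.of_forall fun y => ?_
      rw [expNegInvGlue.zero_of_nonpos ht]
      exact expNegInvGlue.nonneg y
    exact h1.deriv_eq_zero
  have hcl : IsOpen (Metric.closedBall x₀ (R / 2))ᶜ := Metric.isClosed_closedBall.isOpen_compl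
  have hmem : ∀ y, y ∈ (Metric.closedBall x₀ (R / 2))ᶜ → R / 2 < ‖y - x₀‖ := fun y hy => by
    simpa [dist_eq_norm] using hy
  have hψ0 : ∀ y, R / 2 < ‖y - x₀‖ → ψ y = 0 := fun y hy => by
    by_cases hyB : y ∈ B
    · simp [hψ, hyB, hfar y hyB hy]
    · simp [hψ, hyB]
  have hQ0 : ∀ y, R / 2 < ‖y - x₀‖ → Q y = 0 := fun y hy => by
    by_cases hyB : y ∈ B
    · simp [hQ, hyB, hTz _ (hfar y hyB hy)]
    · simp [hQ, hyB]
  have hdich : ∀ x, x ∈ B ∨ x ∈ (Metric.closedBall x₀ (R / 2))ᶜ := fun x => by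
    by_cases hx : x ∈ B
    · exact Or.inl hx
    · refine Or.inr ?_
      simp only [hB, Metric.mem_ball, not_lt] at hx
      simp only [Set.mem_compl_iff, Metric.mem_closedBall, not_le]
      linarith
  have hgrad : ∀ x, HasGradientAt ψ (Q x) x := fun x => by
    rcases hdich x with hx | hx
    · have h1 := (hh.grad x hx).comp_real (f := fun t => expNegInvGlue (t - k))
        ((hTd (h x - k)).comp_sub_const (h x) k)
      have : Q x = deriv expNegInvGlue (h x - k) • p x := (hQB x hx).self_of_nhds
      rw [this]
      exact h1.congr_of_eventuallyEq (hψB x hx)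
    · rw [hQ0 x (hmem x hx)]
      refine (hasGradientAt_const x (0 : ℝ)).congr_of_eventuallyEq ?_
      filter_upwards [hcl.mem_nhds hx] with y hy
      exact hψ0 y (hmem y hy)
  have hQc : Continuous Q := by
    refine continuous_iff_continuousAt.2 fun x => ?_
    rcases hdich x with hx | hx
    · refine ContinuousAt.congr ?_ (hQB x hx).symm
      have c1 : ContinuousAt h x := (hh.grad x hx).continuousAt
      have c2 : ContinuousAt p x := hh.cont_grad.continuousAt (hBo.mem_nhds hx)
      exact (ContinuousAt.comp (f := fun y => h y - k) hTc.continuousAt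
        (c1.sub continuousAt_const)).smul c2
    · refine (continuousAt_const (y := (0 : EuclideanSpace ℝ (Fin N)))).congr ?_
      filter_upwards [hcl.mem_nhds hx] with y hy
      exact (hQ0 y (hmem y hy)).symm
  have hψc1 : ContDiff ℝ 1 ψ := by
    refine contDiff_one_iff_hasFDerivAt.2 ⟨fun x => InnerProductSpace.toDual ℝ _ (Q x), ?_,
      fun x => (hgrad x).hasFDerivAt⟩
    exact (InnerProductSpace.toDual ℝ (EuclideanSpace ℝ (Fin N))).continuous.comp hQc
  have hsupp : tsupport ψ ⊆ Metric.closedBall x₀ (R / 2) := by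
    refine closure_minimal (fun x hx => ?_) Metric.isClosed_closedBall
    by_contra hn
    exact hx (hψ0 x (hmem x hn))
  have hcs : HasCompactSupport ψ :=
    (isCompact_closedBall x₀ (R / 2)).of_isClosed_subset (isClosed_tsupport ψ) hsupp
  have htest : IsTestOn B ψ :=
    ⟨hψc1, hcs, hsupp.trans (Metric.closedBall_subset_ball (by linarith))⟩
  have hweak := hh.weak ψ htest
  have hQg : ∀ x, gradient ψ x = Q x := fun x => (hgrad x).gradient
  have hψnn : ∀ x, 0 ≤ ψ x := fun x => by
    simp only [hψ]
    split_ifs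
    · exact expNegInvGlue.nonneg _
    · exact le_rfl
  have hx₀ : x₀ ∈ B := Metric.mem_ball_self hR
  rw [integral_add (htest.integrable_inner hBo hh.cont_grad)
    (htest.integrable_mul hBo hh.cont_rhs)] at hweak
  have hA : 0 ≤ ∫ x, ⟪p x, gradient ψ x⟫ := by
    refine integral_nonneg fun x => ?_
    simp only [hQg, Pi.zero_apply, hQ]
    split_ifs
    · rw [inner_smul_right, real_inner_self_eq_norm_sq]
      exact mul_nonneg expNegInvGlue.monotone.deriv_nonneg (sq_nonneg _)
    · simp
  have hC : 0 < ∫ x, g x * ψ x := by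
    have hcont : Continuous fun x => g x * ψ x := by
      refine continuous_of_tsupport fun x hx => ?_
      have hxB : x ∈ B := htest.2.2 (tsupport_mul_subset_right hx)
      exact (hh.cont_rhs.continuousAt (hBo.mem_nhds hxB)).mul hψc1.continuous.continuousAt
    refine hcont.integral_pos_of_hasCompactSupport_nonneg_nonzero (x := x₀) hcs.mul_left ?_ ?_
    · intro x
      by_cases hx : x ∈ B
      · exact mul_nonneg (hg x hx).le (hψnn x)
      · simp [hψ, hx]
    · have : 0 < ψ x₀ := by
        simp only [hψ, hx₀, if_true]
        refine expNegInvGlue.pos_of_pos ?_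
        rw [hk]
        have : 0 < ε * (R / 2) ^ 2 := by positivity
        linarith
      exact (mul_pos (hg x₀ hx₀) this).ne'
  linarith

/-- A weak solution touched from above by a `C²` function. -/
lemma WeakPoisson.le_trace_of_isLocalMax (hU : IsOpen U) (hu : WeakPoisson U u p g)
    (hs : IsOpen s) (hφ : HasHessianOn s φ P D) {x₀ : EuclideanSpace ℝ (Fin N)}
    (hxU : x₀ ∈ U) (hxs : x₀ ∈ s) (hmax : IsLocalMax (fun x => u x - φ x) x₀) :
    g x₀ ≤ euclTrace (D x₀) := by
  by_contra hlt
  push Not at hlt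
  obtain ⟨ε, hε, hεlt⟩ : ∃ ε : ℝ, 0 < ε ∧ euclTrace (D x₀) + ε * (2 * N) < g x₀ := by
    refine ⟨(g x₀ - euclTrace (D x₀)) / (2 * N + 1), by
      apply div_pos (by linarith); positivity, ?_⟩
    have h1 : (0 : ℝ) < 2 * N + 1 := by positivity
    have h2 : (g x₀ - euclTrace (D x₀)) / (2 * N + 1) * (2 * N + 1) = g x₀ - euclTrace (D x₀) := by
      field_simp
    have h3 : 0 < (g x₀ - euclTrace (D x₀)) / (2 * N + 1) := div_pos (by linarith) h1
    nlinarith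
  have hφ' := hφ.add ((hasHessianOn_norm_sub_sq (s := s) x₀).const_mul ε)
  have hV : IsOpen (U ∩ s) := hU.inter hs
  have hw := (hu.mono Set.inter_subset_left).sub hV
    ((hφ'.weakPoisson hs).mono (Set.inter_subset_right (s := U)))
  have hcont : ContinuousAt (fun x => g x - euclTrace (D x + ε • (2 : ℝ) •
      ContinuousLinearMap.id ℝ (EuclideanSpace ℝ (Fin N)))) x₀ :=
    hw.cont_rhs.continuousAt (hV.mem_nhds ⟨hxU, hxs⟩)
  have hpos : ∀ᶠ x in 𝓝 x₀, 0 < g x - euclTrace (D x + ε • (2 : ℝ) •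
      ContinuousLinearMap.id ℝ (EuclideanSpace ℝ (Fin N))) := by
    refine hcont.eventually (lt_mem_nhds ?_)
    beta_reduce
    rw [euclTrace_add, euclTrace_smul, euclTrace_smul, euclTrace_id]
    linarith
  obtain ⟨R, hR, hball⟩ := Metric.eventually_nhds_iff_ball.1
    ((hpos.and hmax).and (hV.mem_nhds ⟨hxU, hxs⟩))
  refine (hw.mono (fun x hx => (hball x hx).2)).not_strict_max hR hε (fun x hx => ?_)
    (fun x hx => (hball x hx).1.1)
  have := (hball x hx).1.2
  simp only at this
  simp only [sub_self, norm_zero]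
  nlinarith

lemma WeakPoisson.grad_eq_of_isLocalExtr (hu : WeakPoisson U u p g)
    (hφ : HasHessianOn s φ P D) {x₀ : EuclideanSpace ℝ (Fin N)}
    (hxU : x₀ ∈ U) (hxs : x₀ ∈ s) (hext : IsLocalExtr (fun x => u x - φ x) x₀) :
    p x₀ = P x₀ := by
  have h1 := ((hu.grad x₀ hxU).sub_fun (hφ.grad x₀ hxs)).hasFDerivAt
  have h2 := hext.hasFDerivAt_eq_zero h1
  have h3 : p x₀ - P x₀ = 0 := 
    (InnerProductSpace.toDual ℝ (EuclideanSpace ℝ (Fin N))).map_eq_zero_iff.1 h2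
  exact sub_eq_zero.1 h3

/-- A weak solution touched from below by a `C²` function. -/
lemma WeakPoisson.trace_le_of_isLocalMin (hU : IsOpen U) (hu : WeakPoisson U u p g)
    (hs : IsOpen s) (hφ : HasHessianOn s φ P D) {x₀ : EuclideanSpace ℝ (Fin N)}
    (hxU : x₀ ∈ U) (hxs : x₀ ∈ s) (hmin : IsLocalMin (fun x => u x - φ x) x₀) :
    euclTrace (D x₀) ≤ g x₀ := by
  have h1 := hu.neg.le_trace_of_isLocalMax hU hs (hφ.const_mul (-1)) hxU hxs (by
    have := hmin.neg
    refine this.congr (Filter.Eventually.of_forall fun x => ?_)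
    simp only
    ring)
  rw [euclTrace_smul] at h1
  linarith

end Touching

section GradientEstimate

variable {N : ℕ} {U s : Set (EuclideanSpace ℝ (Fin N))}
  {u g : EuclideanSpace ℝ (Fin N) → ℝ}
  {p : EuclideanSpace ℝ (Fin N) → EuclideanSpace ℝ (Fin N)}

lemma HasGradientAt.comp_add_left {w : EuclideanSpace ℝ (Fin N) → ℝ}
    {a z x : EuclideanSpace ℝ (Fin N)} (hw : HasGradientAt w a (z + x)) :
    HasGradientAt (fun y => w (z + y)) a x := by
  rw [hasGradientAt_iff_hasFDerivAt] at *
  exact hw.comp x ((hasFDerivAt_id x).const_add z)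

/-- The translation of a weak solution. -/
lemma WeakPoisson.comp_add_left (hu : WeakPoisson U u p g) (z : EuclideanSpace ℝ (Fin N)) :
    WeakPoisson ((z + ·) ⁻¹' U) (fun x => u (z + x)) (fun x => p (z + x))
      (fun x => g (z + x)) := by
  have hc : Continuous fun x : EuclideanSpace ℝ (Fin N) => z + x := by fun_prop
  refine ⟨fun x hx => (hu.grad (z + x) hx).comp_add_left,
    hu.cont_grad.comp hc.continuousOn fun x hx => hx,
    hu.cont_rhs.comp hc.continuousOn fun x hx => hx, fun ψ hψ => ?_⟩
  have hts : tsupport (fun x => ψ (-z + x)) = (z + ·) '' tsupport ψ := by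
    have := tsupport_comp_eq_preimage ψ (Homeomorph.addLeft (-z))
    rw [show (fun x => ψ (-z + x)) = ψ ∘ Homeomorph.addLeft (-z) from rfl, this]
    ext x
    simp only [Set.mem_preimage, Set.mem_image]
    constructor
    · intro hx; exact ⟨-z + x, hx, by simp⟩
    · rintro ⟨y, hy, rfl⟩; simpa using hy
  have htest : IsTestOn U (fun x => ψ (-z + x)) := by
    refine ⟨hψ.1.comp (contDiff_const.add contDiff_id), ?_, ?_⟩
    · rw [HasCompactSupport, hts]
      exact IsCompact.image hψ.2.1 hc
    · rw [hts]
      rintro _ ⟨y, hy, rfl⟩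
      exact hψ.2.2 hy
  have h1 := hu.weak _ htest
  rw [← integral_add_left_eq_self _ z] at h1
  rw [← h1]
  congr 1
  ext x
  have hg : gradient (fun x => ψ (-z + x)) (z + x) = gradient ψ x := by
    have h2 : HasGradientAt ψ (gradient ψ x) (-z + (z + x)) := by
      rw [neg_add_cancel_left]
      exact ((hψ.1.differentiable (by norm_num)) x).hasGradientAt
    exact h2.comp_add_left.gradient
  rw [hg, neg_add_cancel_left]

lemma WeakPoisson.inner_grad_le_of_lt (hU : IsOpen U) (hu : WeakPoisson U u p g) {d K M P : ℝ}
    {e : EuclideanSpace ℝ (Fin N)} (he : ‖e‖ = 1) (hd : 0 < d)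
    (hball : Metric.closedBall 0 d ⊆ U)
    (hg : ∀ x ∈ Metric.closedBall 0 d, |g x| ≤ K) (hM : ∀ x ∈ Metric.closedBall 0 d, |u x| ≤ M)
    (hP : K + 2 * N * M / d ^ 2 < P) : 2 * ⟪p 0, e⟫ ≤ P * d := by
  have h0 : (0 : EuclideanSpace ℝ (Fin N)) ∈ Metric.closedBall 0 d := by simp [hd.le]
  have hK0 : 0 ≤ K := (abs_nonneg _).trans (hg 0 h0)
  have hM0 : 0 ≤ M := (abs_nonneg _).trans (hM 0 h0)
  have hP0 : 0 < P := lt_of_le_of_lt (by positivity) hP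
  set σ : EuclideanSpace ℝ (Fin N) ≃ₗᵢ[ℝ] EuclideanSpace ℝ (Fin N) :=
    (ℝ ∙ e)ᗮ.reflection with hσ
  have hV : IsOpen (U ∩ σ ⁻¹' U) := hU.inter (hU.preimage σ.continuous)
  have hw := (hu.mono Set.inter_subset_left).sub hV
    ((hu.comp_isometry σ).mono (Set.inter_subset_right (s := U)))
  have hσb : ∀ x ∈ Metric.closedBall (0 : EuclideanSpace ℝ (Fin N)) d,
      σ x ∈ Metric.closedBall 0 d := fun x hx => by simpa using hx
  have hbV : Metric.closedBall 0 d ⊆ U ∩ σ ⁻¹' U := fun x hx => ⟨hball hx, hball (hσb x hx)⟩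
  have hψ := ((hasHessianOn_norm_sub_sq (s := Set.univ)
      (0 : EuclideanSpace ℝ (Fin N))).const_mul (2 * M / d ^ 2)).add
    ((hasHessianOn_inner (s := Set.univ) e).comp_real (f := fun t => P * d * t - P * t ^ 2)
      (f' := fun t => P * d - P * (2 * t)) (f'' := fun _ => -(P * 2))
      (fun x _ => by
        have := ((hasDerivAt_id ⟪e, x⟫).const_mul (P * d)).sub
          (((hasDerivAt_id ⟪e, x⟫).pow 2).const_mul P)
        convert! this using 1
        simp)
      (fun x _ => by
        have := (((hasDerivAt_id ⟪e, x⟫).const_mul 2).const_mul P).const_sub (P * d)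
        simpa using this) continuousOn_const)
  set ψ : EuclideanSpace ℝ (Fin N) → ℝ := fun x =>
    2 * M / d ^ 2 * ‖x - 0‖ ^ 2 + (P * d * ⟪e, x⟫ - P * ⟪e, x⟫ ^ 2) with hψdef
  set S : Set (EuclideanSpace ℝ (Fin N)) := Metric.closedBall 0 d ∩ {x | 0 ≤ ⟪e, x⟫} with hS
  have hSc : IsCompact S := (isCompact_closedBall _ _).inter_right
    (isClosed_le continuous_const (by fun_prop))
  have hSn : S.Nonempty := ⟨0, h0, by simp⟩
  have hinner : ∀ x ∈ Metric.closedBall (0 : EuclideanSpace ℝ (Fin N)) d, ⟪e, x⟫ ≤ d := by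
    intro x hx
    have := real_inner_le_norm e x
    rw [he, one_mul] at this
    exact this.trans (by simpa using hx)
  have key : ∀ x ∈ S, u x - u (σ x) ≤ ψ x := by
    obtain ⟨x₀, hx₀, hmax⟩ := hSc.exists_isMaxOn hSn
      (f := fun x => (u x - u (σ x)) - ψ x) (by
        refine ContinuousOn.sub ((hw.continuousOn).mono fun x hx => hbV hx.1) ?_
        exact (hψ.weakPoisson isOpen_univ).continuousOn.mono (Set.subset_univ _))
    suffices hle : (u x₀ - u (σ x₀)) - ψ x₀ ≤ 0 by
      intro x hx
      have := hmax hx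
      simp only [Set.mem_ofPred_eq] at this
      linarith
    have hx0b : ‖x₀‖ ≤ d := by simpa using hx₀.1
    have ht0 : 0 ≤ ⟪e, x₀⟫ := hx₀.2
    have htd := hinner x₀ hx₀.1
    have hq : 0 ≤ P * d * ⟪e, x₀⟫ - P * ⟪e, x₀⟫ ^ 2 := by
      have : 0 ≤ P * (⟪e, x₀⟫ * (d - ⟪e, x₀⟫)) := by
        have : 0 ≤ d - ⟪e, x₀⟫ := by linarith
        positivity
      nlinarith
    rcases ht0.eq_or_lt with hte | htpos
    · have hfix : σ x₀ = x₀ := by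
        rw [hσ, Submodule.reflection_eq_self_iff, Submodule.mem_orthogonal_singleton_iff_inner_right]
        exact hte.symm
      rw [hfix]
      have : 0 ≤ 2 * M / d ^ 2 * ‖x₀ - 0‖ ^ 2 := by positivity
      simp only [hψdef]
      linarith
    · rcases hx0b.eq_or_lt with hxd | hxd
      · have h1 : 2 * M / d ^ 2 * ‖x₀ - 0‖ ^ 2 = 2 * M := by
          rw [sub_zero, hxd]
          field_simp
        have h2 := abs_le.1 (hM x₀ hx₀.1)
        have h3 := abs_le.1 (hM (σ x₀) (hσb _ hx₀.1))
        simp only [hψdef, h1]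
        linarith
      · exfalso
        have hloc : IsLocalMax (fun x => (u x - u (σ x)) - ψ x) x₀ := by
          refine hmax.isLocalMax ?_
          have o1 : Metric.ball (0 : EuclideanSpace ℝ (Fin N)) d ∈ 𝓝 x₀ :=
            Metric.isOpen_ball.mem_nhds (by simpa using hxd)
          have o2 : {x | 0 < ⟪e, x⟫} ∈ 𝓝 x₀ :=
            (isOpen_lt continuous_const (by fun_prop)).mem_nhds htpos
          filter_upwards [o1, o2] with x h1 h2
          exact ⟨Metric.ball_subset_closedBall h1, le_of_lt h2⟩
        have := hw.le_trace_of_isLocalMax hV isOpen_univ hψ (hbV hx₀.1) trivial hloc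
        rw [euclTrace_add, euclTrace_smul, euclTrace_smul, euclTrace_id, euclTrace_add,
          euclTrace_smul, euclTrace_smul, euclTrace_zero, euclTrace_smulRight, he] at this
        have h2 := abs_le.1 (hg x₀ hx₀.1)
        have h3 := abs_le.1 (hg (σ x₀) (hσb _ hx₀.1))
        have h4 : 2 * M / d ^ 2 * (2 * N) = 2 * (2 * N * M / d ^ 2) := by ring
        rw [h4] at this
        linarith
  have hσe : σ e = -e := Submodule.reflection_orthogonalComplement_singleton_eq_neg e
  have hγ : HasFDerivAt (fun x => u x - u (σ x)) (InnerProductSpace.toDual ℝ _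
      (p 0 - σ.symm (p (σ 0)))) 0 := (hw.grad 0 (hbV h0)).hasFDerivAt
  have hline : HasDerivAt (fun t : ℝ => t • e) e 0 := by
    simpa using (hasDerivAt_id (0 : ℝ)).smul_const e
  have hder : HasDerivAt (fun t : ℝ => u (t • e) - u (σ (t • e))) (2 * ⟪p 0, e⟫) 0 := by
    have h1 := HasFDerivAt.comp_hasDerivAt (0 : ℝ) (f := fun t : ℝ => t • e)
      (by simpa using hγ) hline
    convert! h1 using 1
    rw [_root_.sub_apply, InnerProductSpace.toDual_apply_apply,
      InnerProductSpace.toDual_apply_apply, ← σ.inner_map_map (σ.symm _), hσe]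
    simp
    ring
  have hder2 : HasDerivAt (fun t : ℝ => 2 * M / d ^ 2 * t ^ 2 + (P * d * t - P * t ^ 2)
      - (u (t • e) - u (σ (t • e)))) (P * d - 2 * ⟪p 0, e⟫) 0 := by
    have h1 := (((hasDerivAt_pow 2 (0 : ℝ)).const_mul (2 * M / d ^ 2)).add
      (((hasDerivAt_id (0 : ℝ)).const_mul (P * d)).sub
        ((hasDerivAt_pow 2 (0 : ℝ)).const_mul P))).sub hder
    convert! h1 using 1
    simp
  have hslope := (hasDerivAt_iff_tendsto_slope.1 hder2).mono_left
    (nhdsWithin_mono (s := Set.Ioi (0 : ℝ)) (0 : ℝ) (fun t ht => ne_of_gt ht))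
  have : 0 ≤ P * d - 2 * ⟪p 0, e⟫ := by
    refine ge_of_tendsto hslope ?_
    filter_upwards [Ioo_mem_nhdsGT hd] with t ht
    have hnorm : ‖t • e‖ = t := by rw [norm_smul, he, mul_one, Real.norm_of_nonneg ht.1.le]
    have hin : ⟪e, t • e⟫ = t := by
      rw [inner_smul_right, real_inner_self_eq_norm_sq, he]; ring
    have hmem : t • e ∈ S := by
      refine ⟨by simpa [hnorm] using ht.2.le, ?_⟩
      show 0 ≤ ⟪e, t • e⟫
      rw [hin]
      exact ht.1.le
    have h2 := key _ hmem
    simp only [hψdef, sub_zero, hnorm, hin] at h2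
    rw [slope_def_field]
    refine div_nonneg ?_ (by linarith [ht.1])
    simp only [zero_smul, map_zero]
    nlinarith
  linarith

/-- Interior gradient estimate for Poisson's equation. -/
lemma WeakPoisson.norm_grad_le (hU : IsOpen U) (hu : WeakPoisson U u p g) {d K M : ℝ}
    {z : EuclideanSpace ℝ (Fin N)} (hd : 0 < d)
    (hball : Metric.closedBall z d ⊆ U)
    (hg : ∀ x ∈ Metric.closedBall z d, |g x| ≤ K) (hM : ∀ x ∈ Metric.closedBall z d, |u x| ≤ M) :
    ‖p z‖ ≤ K * d / 2 + N * M / d := by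
  have hz : z ∈ Metric.closedBall z d := by simp [hd.le]
  have hK0 : 0 ≤ K := (abs_nonneg _).trans (hg z hz)
  have hM0 : 0 ≤ M := (abs_nonneg _).trans (hM z hz)
  by_cases hp : p z = 0
  · rw [hp, norm_zero]
    positivity
  have hmem : ∀ x ∈ Metric.closedBall (0 : EuclideanSpace ℝ (Fin N)) d,
      z + x ∈ Metric.closedBall z d := fun x hx => by simpa [dist_eq_norm] using hx
  have hpn : 0 < ‖p z‖ := norm_pos_iff.2 hp
  have key : ∀ P, K + 2 * N * M / d ^ 2 < P → 2 * ‖p z‖ ≤ P * d := by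
    intro P hP
    have := (hu.comp_add_left z).inner_grad_le_of_lt (hU.preimage (by fun_prop))
      (e := ‖p z‖⁻¹ • p z) (by rw [norm_smul, norm_inv, norm_norm, inv_mul_cancel₀ hpn.ne']) hd
      (fun x hx => hball (hmem x hx)) (fun x hx => hg _ (hmem x hx))
      (fun x hx => hM _ (hmem x hx)) hP
    rw [add_zero, inner_smul_right, real_inner_self_eq_norm_sq] at this
    convert this using 2
    field_simp
  have h1 : 2 * ‖p z‖ / d ≤ K + 2 * N * M / d ^ 2 :=
    le_of_forall_gt_imp_ge_of_dense fun P hP => by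
      rw [div_le_iff₀ hd]
      exact key P hP
  rw [div_le_iff₀ hd] at h1
  have h2 : (K + 2 * N * M / d ^ 2) * d = 2 * (K * d / 2 + N * M / d) := by
    field_simp
  linarith

end GradientEstimate

section LogTransform

variable {N : ℕ} {U : Set (EuclideanSpace ℝ (Fin N))}
  {u g h : EuclideanSpace ℝ (Fin N) → ℝ}
  {p : EuclideanSpace ℝ (Fin N) → EuclideanSpace ℝ (Fin N)}

lemma WeakPoisson.congr_rhs (hu : WeakPoisson U u p g) (h1 : ∀ x ∈ U, g x = h x) :
    WeakPoisson U u p h := by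
  refine ⟨hu.grad, hu.cont_grad, hu.cont_rhs.congr fun x hx => (h1 x hx).symm, fun ψ hψ => ?_⟩
  rw [← hu.weak ψ hψ]
  congr 1
  ext x
  by_cases hx : x ∈ U
  · rw [h1 x hx]
  · rw [image_eq_zero_of_notMem_tsupport fun hx' => hx (hψ.2.2 hx')]
    simp

lemma WeakPoisson.contDiffAt (hU : IsOpen U) (hu : WeakPoisson U u p g)
    {x : EuclideanSpace ℝ (Fin N)} (hx : x ∈ U) : ContDiffAt ℝ 1 u x :=
  contDiffAt_one_iff.2 ⟨fun x => InnerProductSpace.toDual ℝ _ (p x), U, hU.mem_nhds hx,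
    (InnerProductSpace.toDual ℝ (EuclideanSpace ℝ (Fin N))).continuous.comp_continuousOn
      hu.cont_grad, fun y hy => (hu.grad y hy).hasFDerivAt⟩

/-- The equation satisfied by the logarithm of a positive weak solution. -/
lemma WeakPoisson.log (hU : IsOpen U) (hu : WeakPoisson U u p g) (hpos : ∀ x ∈ U, 0 < u x) :
    WeakPoisson U (fun x => Real.log (u x)) (fun x => (u x)⁻¹ • p x)
      (fun x => g x / u x - ‖(u x)⁻¹ • p x‖ ^ 2) := by
  have hne : ∀ x ∈ U, u x ≠ 0 := fun x hx => (hpos x hx).ne'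
  have hc : ContinuousOn (fun x => (u x)⁻¹ • p x) U :=
    (hu.continuousOn.inv₀ hne).smul hu.cont_grad
  refine ⟨fun x hx => ?_, hc, (hu.cont_rhs.div hu.continuousOn hne).sub (hc.norm.pow 2),
    fun ψ hψ => ?_⟩
  · exact (hu.grad x hx).comp_real (hasDerivAt_log (hne x hx))
  · have hzero : ∀ x, x ∉ tsupport ψ → ψ x = 0 := fun x hx => image_eq_zero_of_notMem_tsupport hx
    have hsub : tsupport (fun x => ψ x * (u x)⁻¹) ⊆ tsupport ψ := tsupport_mul_subset_left
    have htest : IsTestOn U (fun x => ψ x * (u x)⁻¹) := by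
      refine ⟨contDiff_iff_contDiffAt.2 fun x => ?_,
        IsCompact.of_isClosed_subset hψ.2.1 (isClosed_tsupport _) hsub, hsub.trans hψ.2.2⟩
      by_cases hx : x ∈ tsupport ψ
      · exact hψ.1.contDiffAt.mul ((hu.contDiffAt hU (hψ.2.2 hx)).inv (hne x (hψ.2.2 hx)))
      · refine (contDiffAt_const (c := (0 : ℝ))).congr_of_eventuallyEq ?_
        filter_upwards [(isClosed_tsupport ψ).isOpen_compl.mem_nhds hx] with y hy
        rw [hzero y hy, zero_mul]
    rw [← hu.weak _ htest]
    congr 1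
    ext x
    by_cases hx : x ∈ tsupport ψ
    · have hxU := hψ.2.2 hx
      have h1 : HasGradientAt (fun x => ψ x * (u x)⁻¹)
          ((u x)⁻¹ • gradient ψ x - (ψ x * ((u x) ^ 2)⁻¹) • p x) x := by
        rw [hasGradientAt_iff_hasFDerivAt]
        have a1 := ((hψ.1.differentiable (by norm_num)) x).hasGradientAt.hasFDerivAt
        have a2 := ((hu.grad x hxU).comp_real (hasDerivAt_inv (hne x hxU))).hasFDerivAt
        have := a1.mul a2
        convert! this using 1
        ext y
        simp
        ring
      rw [h1.gradient, inner_sub_right, inner_smul_right, inner_smul_right, inner_smul_left,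
        norm_smul, real_inner_self_eq_norm_sq, mul_pow, norm_inv, norm_eq_abs, inv_pow, sq_abs]
      simp
      ring
    · rw [gradient_eq_zero_of_notMem_tsupport hx, hzero x hx,
        gradient_eq_zero_of_notMem_tsupport fun h => hx (hsub h)]
      simp

/-- The right-hand side of the equation satisfied by the logarithm of a solution. -/
def logRhs {N : ℕ} (ρ lam τ θ q : ℝ) (w : EuclideanSpace ℝ (Fin N) → ℝ)
    (p : EuclideanSpace ℝ (Fin N) → EuclideanSpace ℝ (Fin N)) (x : EuclideanSpace ℝ (Fin N)) : ℝ :=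
  -‖p x‖ ^ 2 + ((N : ℝ) - 2 + 2 * ρ) * (⟪x, p x⟫ / ‖x‖ ^ 2)
    - lam * (‖p x‖ ^ (1 - τ) / ‖x‖ ^ (τ + 1)) + ‖x‖ ^ θ * Real.exp ((q - 1) * w x)

lemma IsSolutionE.weakPoisson {ρ lam τ θ q : ℝ} {Ω : Set (EuclideanSpace ℝ (Fin N))}
    (hΩ : IsOpen Ω) (hτ1 : τ < 1)
    (hu : IsSolutionE N ρ lam τ θ q Ω u) :
    WeakPoisson (Ω \ {0}) u (gradient u) (fun x =>
      ((N : ℝ) - 2 + 2 * ρ) * (⟪x, gradient u x⟫ / ‖x‖ ^ 2)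
        - lam * Gt τ x (u x) (gradient u x) + ‖x‖ ^ θ * u x ^ q) := by
  have hU : IsOpen (Ω \ {0}) := hΩ.sdiff isClosed_singleton
  obtain ⟨⟨hC1, hpos⟩, hweak⟩ := hu
  have hx0 : ∀ x ∈ Ω \ {(0 : EuclideanSpace ℝ (Fin N))}, ‖x‖ ≠ 0 := fun x hx =>
    norm_ne_zero_iff.2 hx.2
  have hgc : ContinuousOn (gradient u) (Ω \ {0}) :=
    (InnerProductSpace.toDual ℝ (EuclideanSpace ℝ (Fin N))).symm.continuous.comp_continuousOn
      (hC1.continuousOn_fderiv_of_isOpen hU le_rfl)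
  have huc := hC1.continuousOn
  have hnc : ContinuousOn (fun x : EuclideanSpace ℝ (Fin N) => ‖x‖) (Ω \ {0}) :=
    continuous_norm.continuousOn
  have c1 : ContinuousOn (fun x => ⟪x, gradient u x⟫ / ‖x‖ ^ 2) (Ω \ {0}) :=
    (continuousOn_id.inner hgc).div (hnc.pow 2) fun x hx => pow_ne_zero 2 (hx0 x hx)
  have c2 : ContinuousOn (fun x => Gt τ x (u x) (gradient u x)) (Ω \ {0}) := by
    unfold Gt
    refine ((huc.rpow_const fun x hx => Or.inl (hpos x hx).ne').mul
      (hgc.norm.rpow_const fun x hx => Or.inr (by linarith))).div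
      (hnc.rpow_const fun x hx => Or.inl (hx0 x hx)) fun x hx => ?_
    exact (rpow_pos_of_pos (norm_pos_iff.2 hx.2) _).ne'
  have c3 : ContinuousOn (fun x => ‖x‖ ^ θ * u x ^ q) (Ω \ {0}) :=
    (hnc.rpow_const fun x hx => Or.inl (hx0 x hx)).mul
      (huc.rpow_const fun x hx => Or.inl (hpos x hx).ne')
  refine ⟨fun x hx => ?_, hgc, ((c1.const_smul ((N : ℝ) - 2 + 2 * ρ)).sub
    (c2.const_smul lam)).add c3, fun ψ hψ => ?_⟩
  · exact ((hC1.differentiableOn (by norm_num)).differentiableAt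
      (hU.mem_nhds hx)).hasGradientAt
  · have hw := hweak ψ hψ
    have hz : ∀ x ∉ Ω \ {(0 : EuclideanSpace ℝ (Fin N))}, ψ x = 0 := fun x hx =>
      image_eq_zero_of_notMem_tsupport fun h => hx (hψ.2.2 h)
    have hz' : ∀ x ∉ Ω \ {(0 : EuclideanSpace ℝ (Fin N))}, gradient ψ x = 0 := fun x hx =>
      gradient_eq_zero_of_notMem_tsupport fun h => hx (hψ.2.2 h)
    rw [weakE, setIntegral_eq_integral_of_forall_compl_eq_zero fun x hx => by rw [hz' x hx]; simp,
      setIntegral_eq_integral_of_forall_compl_eq_zero fun x hx => by rw [hz x hx]; simp,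
      setIntegral_eq_integral_of_forall_compl_eq_zero fun x hx => by rw [hz x hx]; simp,
      setIntegral_eq_integral_of_forall_compl_eq_zero fun x hx => by rw [hz x hx]; simp,
      ← integral_const_mul, ← integral_const_mul] at hw
    have i0 := hψ.integrable_inner hU hgc
    have i1 := (hψ.integrable_mul hU c1).const_mul ((N : ℝ) - 2 + 2 * ρ)
    have i2 := (hψ.integrable_mul hU c2).const_mul lam
    have i3 := hψ.integrable_mul hU c3
    have e1 := integral_add i0 i1
    have e2 := integral_sub (i0.add i1) i2
    have e3 := integral_add ((i0.add i1).sub i2) i3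
    simp only [Pi.add_apply, Pi.sub_apply] at e2 e3
    rw [← e1, ← e2, ← e3] at hw
    rw [← hw]
    congr 1
    ext x
    ring

/-- The equation satisfied by the logarithm of a positive solution of (E). -/
lemma IsSolutionE.weakPoisson_log {ρ lam τ θ q : ℝ} {Ω : Set (EuclideanSpace ℝ (Fin N))}
    (hΩ : IsOpen Ω) (hτ1 : τ < 1) (hu : IsSolutionE N ρ lam τ θ q Ω u) :
    WeakPoisson (Ω \ {0}) (fun x => Real.log (u x)) (fun x => (u x)⁻¹ • gradient u x)
      (logRhs ρ lam τ θ q (fun x => Real.log (u x)) (fun x => (u x)⁻¹ • gradient u x)) := by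
  refine ((hu.weakPoisson hΩ hτ1).log (hΩ.sdiff isClosed_singleton) hu.1.2).congr_rhs
    fun x hx => ?_
  have hpos := hu.1.2 x hx
  have e1 : Real.exp ((q - 1) * Real.log (u x)) = u x ^ q / u x := by
    rw [mul_comm, ← rpow_def_of_pos hpos, rpow_sub_one hpos.ne']
  have e2 : ‖(u x)⁻¹ • gradient u x‖ ^ (1 - τ) = u x ^ τ * ‖gradient u x‖ ^ (1 - τ) / u x := by
    rw [norm_smul, norm_inv, norm_of_nonneg hpos.le, mul_rpow (by positivity) (norm_nonneg _),
      inv_rpow hpos.le, rpow_sub hpos, rpow_one]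
    field_simp
  rw [logRhs, e1, e2, inner_smul_right, Gt]
  field_simp
  ring

end LogTransform

section Radial

variable {N : ℕ} {U : Set (EuclideanSpace ℝ (Fin N))}
  {w : EuclideanSpace ℝ (Fin N) → ℝ}
  {p : EuclideanSpace ℝ (Fin N) → EuclideanSpace ℝ (Fin N)}

/-- The Hessian of a radial function, written in the variable `log ‖x‖`. -/
lemma exists_hasHessianOn_radial {I : Set ℝ} {φ φ' φ'' : ℝ → ℝ}
    (h1 : ∀ s ∈ I, HasDerivAt φ (φ' s) s) (h2 : ∀ s ∈ I, HasDerivAt φ' (φ'' s) s)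
    (h3 : ContinuousOn φ'' I) :
    ∃ D, HasHessianOn {x : EuclideanSpace ℝ (Fin N) | x ≠ 0 ∧ Real.log ‖x‖ ∈ I}
      (fun x => φ (Real.log ‖x‖)) (fun x => (φ' (Real.log ‖x‖) / ‖x‖ ^ 2) • x) D ∧
      ∀ x, x ≠ 0 → euclTrace (D x)
        = (φ'' (Real.log ‖x‖) + ((N : ℝ) - 2) * φ' (Real.log ‖x‖)) / ‖x‖ ^ 2 := by
  set V := {x : EuclideanSpace ℝ (Fin N) | x ≠ 0 ∧ Real.log ‖x‖ ∈ I} with hV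
  have hlog : ∀ x : EuclideanSpace ℝ (Fin N),
      Real.log (‖x - 0‖ ^ 2) / 2 = Real.log ‖x‖ := fun x => by
    rw [sub_zero, Real.log_pow]; push_cast; ring
  have hn : ∀ x ∈ V, ‖x - 0‖ ^ 2 ≠ 0 := fun x hx => by
    rw [sub_zero]; exact pow_ne_zero 2 (norm_ne_zero_iff.2 hx.1)
  have hd : ∀ x ∈ V, HasDerivAt (fun y => Real.log y / 2) ((‖x - 0‖ ^ 2)⁻¹ / 2) (‖x - 0‖ ^ 2) :=
    fun x hx => (hasDerivAt_log (hn x hx)).div_const 2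
  have key := (hasHessianOn_norm_sub_sq (s := V) (0 : EuclideanSpace ℝ (Fin N))).comp_real
    (f := fun y => φ (Real.log y / 2)) (f' := fun y => φ' (Real.log y / 2) * (y⁻¹ / 2))
    (f'' := fun y => φ'' (Real.log y / 2) * (y⁻¹ / 2) * (y⁻¹ / 2)
      + φ' (Real.log y / 2) * (-(y ^ 2)⁻¹ / 2))
    (fun x hx => by
      have := h1 (Real.log (‖x - 0‖ ^ 2) / 2) (by rw [hlog]; exact hx.2)
      exact HasDerivAt.comp (‖x - 0‖ ^ 2) (h := fun y => Real.log y / 2) this (hd x hx))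
    (fun x hx => by
      have := h2 (Real.log (‖x - 0‖ ^ 2) / 2) (by rw [hlog]; exact hx.2)
      exact (HasDerivAt.comp (‖x - 0‖ ^ 2) (h := fun y => Real.log y / 2) this (hd x hx)).mul
        ((hasDerivAt_inv (hn x hx)).div_const 2))
    (by
      simp only [hlog]
      have c0 : ContinuousOn (fun x : EuclideanSpace ℝ (Fin N) => Real.log ‖x‖) V :=
        continuous_norm.continuousOn.log fun x hx => norm_ne_zero_iff.2 hx.1
      have c1 : ContinuousOn (fun x : EuclideanSpace ℝ (Fin N) => (‖x - 0‖ ^ 2)⁻¹) V :=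
        ContinuousOn.inv₀ (by fun_prop) hn
      have c2 : ContinuousOn (fun x : EuclideanSpace ℝ (Fin N) => ((‖x - 0‖ ^ 2) ^ 2)⁻¹) V :=
        ContinuousOn.inv₀ (by fun_prop) fun x hx => pow_ne_zero 2 (hn x hx)
      have c3 : ContinuousOn φ' I := fun s hs => (h2 s hs).continuousAt.continuousWithinAt
      have c4 := h3.comp c0 fun x hx => hx.2
      have c5 := c3.comp c0 fun x hx => hx.2
      exact ((c4.mul (c1.div_const 2)).mul (c1.div_const 2)).add (c5.mul (c2.neg.div_const 2)))
  simp only [hlog] at key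
  refine ⟨_, ⟨fun x hx => ?_, fun x hx => ?_, key.cont⟩, fun x hx => ?_⟩
  · convert! key.grad x hx using 1
    rw [smul_smul, sub_zero]
    congr 1
    field_simp
  · have : (fun x : EuclideanSpace ℝ (Fin N) => (φ' (Real.log ‖x‖) / ‖x‖ ^ 2) • x) =
      fun x => (φ' (Real.log ‖x‖) * ((‖x - 0‖ ^ 2)⁻¹ / 2)) • (2 : ℝ) • (x - 0) := by
      ext1 x
      rw [smul_smul, sub_zero]
      congr 1
      field_simp
    rw [this]
    exact key.hess x hx
  · have : ‖x‖ ≠ 0 := norm_ne_zero_iff.2 hx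
    rw [euclTrace_add, euclTrace_smul, euclTrace_smul, euclTrace_smul, euclTrace_id,
      euclTrace_smulRight, norm_smul, sub_zero]
    norm_num
    field_simp
    ring

/-- The first order part of the radial form of the equation. -/
def radialH (ρ lam τ t : ℝ) : ℝ := t ^ 2 - 2 * ρ * t + lam * |t| ^ (1 - τ)

lemma logRhs_eq_of_radial {ρ lam τ θ q b t : ℝ} (hb : θ + 2 = -((q - 1) * b))
    {x : EuclideanSpace ℝ (Fin N)} (hx : x ≠ 0) (hp : p x = (t / ‖x‖ ^ 2) • x) :
    logRhs ρ lam τ θ q w p x = (Real.exp ((q - 1) * (w x - b * Real.log ‖x‖))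
      - radialH ρ lam τ t + ((N : ℝ) - 2) * t) / ‖x‖ ^ 2 := by
  have hr : 0 < ‖x‖ := norm_pos_iff.2 hx
  have e1 : ‖p x‖ = |t| / ‖x‖ := by
    rw [hp, norm_smul, norm_div, norm_pow, norm_norm, norm_eq_abs]
    field_simp
  have e2 : ⟪x, p x⟫ = t := by
    rw [hp, inner_smul_right, real_inner_self_eq_norm_sq]
    field_simp
  have e3 : ‖p x‖ ^ (1 - τ) / ‖x‖ ^ (τ + 1) = |t| ^ (1 - τ) / ‖x‖ ^ 2 := by
    rw [e1, div_rpow (abs_nonneg t) hr.le, div_div, ← rpow_add hr,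
      show 1 - τ + (τ + 1) = (2 : ℕ) by push_cast; ring, rpow_natCast]
  have e4 : ‖x‖ ^ θ * Real.exp ((q - 1) * w x)
      = Real.exp ((q - 1) * (w x - b * Real.log ‖x‖)) / ‖x‖ ^ 2 := by
    have : ‖x‖ ^ 2 = Real.exp (2 * Real.log ‖x‖) := by
      rw [mul_comm, Real.exp_mul, Real.exp_log hr]; norm_num
    rw [this, rpow_def_of_pos hr, ← Real.exp_add, ← Real.exp_sub]
    congr 1
    linear_combination Real.log ‖x‖ * hb
  rw [logRhs, e3, e4, e1, e2, radialH, div_pow, sq_abs]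
  ring

lemma isOpen_radial {I : Set ℝ} (hI : IsOpen I) :
    IsOpen {x : EuclideanSpace ℝ (Fin N) | x ≠ 0 ∧ Real.log ‖x‖ ∈ I} := by
  have : ContinuousOn (fun x : EuclideanSpace ℝ (Fin N) => Real.log ‖x‖) {0}ᶜ :=
    continuous_norm.continuousOn.log fun x hx => norm_ne_zero_iff.2 hx
  exact this.isOpen_inter_preimage isOpen_compl_singleton hI

variable {ρ lam τ θ q b : ℝ} {I : Set ℝ} {φ φ' φ'' : ℝ → ℝ}

lemma WeakPoisson.exp_le_of_isLocalMax_radial (hU : IsOpen U)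
    (hw : WeakPoisson U w p (logRhs ρ lam τ θ q w p)) (hb : θ + 2 = -((q - 1) * b))
    (hI : IsOpen I) (h1 : ∀ s ∈ I, HasDerivAt φ (φ' s) s)
    (h2 : ∀ s ∈ I, HasDerivAt φ' (φ'' s) s) (h3 : ContinuousOn φ'' I)
    {x : EuclideanSpace ℝ (Fin N)} (hxU : x ∈ U) (hx : x ≠ 0) (hxI : Real.log ‖x‖ ∈ I)
    (hmax : IsLocalMax (fun y => w y - φ (Real.log ‖y‖)) x) :
    Real.exp ((q - 1) * (w x - b * Real.log ‖x‖))
      ≤ φ'' (Real.log ‖x‖) + radialH ρ lam τ (φ' (Real.log ‖x‖)) := by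
  obtain ⟨D, hD, htr⟩ := exists_hasHessianOn_radial (N := N) h1 h2 h3
  have hp := hw.grad_eq_of_isLocalExtr hD hxU ⟨hx, hxI⟩ (Or.inr hmax)
  have := hw.le_trace_of_isLocalMax hU (isOpen_radial hI) hD hxU ⟨hx, hxI⟩ hmax
  have hr : 0 < ‖x‖ ^ 2 := by have := norm_pos_iff.2 hx; positivity
  rw [htr x hx, logRhs_eq_of_radial hb hx hp, div_le_div_iff_of_pos_right hr] at this
  linarith

lemma WeakPoisson.le_exp_of_isLocalMin_radial (hU : IsOpen U)
    (hw : WeakPoisson U w p (logRhs ρ lam τ θ q w p)) (hb : θ + 2 = -((q - 1) * b))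
    (hI : IsOpen I) (h1 : ∀ s ∈ I, HasDerivAt φ (φ' s) s)
    (h2 : ∀ s ∈ I, HasDerivAt φ' (φ'' s) s) (h3 : ContinuousOn φ'' I)
    {x : EuclideanSpace ℝ (Fin N)} (hxU : x ∈ U) (hx : x ≠ 0) (hxI : Real.log ‖x‖ ∈ I)
    (hmin : IsLocalMin (fun y => w y - φ (Real.log ‖y‖)) x) :
    φ'' (Real.log ‖x‖) + radialH ρ lam τ (φ' (Real.log ‖x‖))
      ≤ Real.exp ((q - 1) * (w x - b * Real.log ‖x‖)) := by
  obtain ⟨D, hD, htr⟩ := exists_hasHessianOn_radial (N := N) h1 h2 h3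
  have hp := hw.grad_eq_of_isLocalExtr hD hxU ⟨hx, hxI⟩ (Or.inl hmin)
  have := hw.trace_le_of_isLocalMin hU (isOpen_radial hI) hD hxU ⟨hx, hxI⟩ hmin
  have hr : 0 < ‖x‖ ^ 2 := by have := norm_pos_iff.2 hx; positivity
  rw [htr x hx, logRhs_eq_of_radial hb hx hp, div_le_div_iff_of_pos_right hr] at this
  linarith

end Radial

section RadialH

variable {ρ lam τ : ℝ}

/-- The quotient `radialH t / t` for positive `t`. -/
def radialK (ρ lam τ t : ℝ) : ℝ := t - 2 * ρ + lam * t ^ (-τ)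

lemma radialH_eq_mul {t : ℝ} (ht : 0 < t) : radialH ρ lam τ t = t * radialK ρ lam τ t := by
  rw [radialH, radialK, abs_of_pos ht, sub_eq_add_neg 1 τ, rpow_add ht, rpow_one]
  ring

lemma fRho_neg {t : ℝ} : fRho ρ lam τ (-t) = radialH ρ lam τ t := by
  rw [fRho, radialH, abs_neg]
  ring

lemma radialK_eq_zero {w : ℝ} (hw : w < 0) (h : fRho ρ lam τ w = 0) :
    radialK ρ lam τ (-w) = 0 := by
  have hpos : 0 < -w := by linarith
  rw [← neg_neg w, fRho_neg, radialH_eq_mul hpos] at h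
  exact (mul_eq_zero.1 h).resolve_left hpos.ne'

lemma convexOn_radialK (hlam : 0 ≤ lam) (hτ : 0 ≤ τ) :
    ConvexOn ℝ (Set.Ioi 0) (radialK ρ lam τ) := by
  have h1 : ConvexOn ℝ (Set.Ioi 0) fun t : ℝ => -τ * Real.log t := by
    have := (strictConcaveOn_log_Ioi.concaveOn.neg).smul hτ
    refine this.congr fun t _ => ?_
    simp
  have h2 : ConvexOn ℝ (Set.Ioi 0) fun t : ℝ => t ^ (-τ) := by
    have h3 : Convex ℝ ((fun t : ℝ => -τ * Real.log t) '' Set.Ioi 0) := by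
      refine Real.convex_iff_isPreconnected.2 ?_
      refine (convex_Ioi (0 : ℝ)).isPreconnected.image _ ?_
      exact ContinuousOn.mul continuousOn_const
        (continuousOn_log.mono fun t ht => ne_of_gt ht)
    have := ConvexOn.comp (convexOn_exp.subset (Set.subset_univ _) h3) h1
      (Real.exp_monotone.monotoneOn _)
    refine this.congr fun t ht => ?_
    simp only [Function.comp]
    rw [rpow_def_of_pos ht, mul_comm]
  have h4 : ConvexOn ℝ (Set.Ioi 0) fun t : ℝ => t + -(2 * ρ) :=
    (convexOn_id (convex_Ioi 0)).add (convexOn_const _ (convex_Ioi 0))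
  refine (h4.add (h2.smul hlam)).congr fun t _ => ?_
  simp [radialK]
  ring

lemma radialK_critical (hlam : 0 < lam) (hτ : 0 < τ) :
    radialK ρ lam τ ((lam * τ) ^ (1 / (τ + 1))) = 2 * Upsilon lam τ - 2 * ρ := by
  have hpos : 0 < lam * τ := mul_pos hlam hτ
  set c := (lam * τ) ^ (1 / (τ + 1)) with hc
  have hc0 : 0 < c := rpow_pos_of_pos hpos _
  have h1 : c ^ (τ + 1) = lam * τ := by
    rw [hc, ← rpow_mul hpos.le]
    rw [one_div_mul_cancel (by linarith), rpow_one]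
  have h2 : lam * c ^ (-τ) = c / τ := by
    rw [rpow_add hc0, rpow_one] at h1
    rw [rpow_neg hc0.le, eq_div_iff hτ.ne']
    have : c ^ τ ≠ 0 := (rpow_pos_of_pos hc0 _).ne'
    field_simp
    linarith
  rw [radialK, h2, Upsilon, ← hc]
  field_simp
  ring

/-- The sign information on the first order part used in the construction of barriers. -/
structure RadialBounds (ρ lam τ b m ε h : ℝ) : Prop where
  b_pos : 0 < b
  b_lt : b < m
  ε_pos : 0 < ε
  h_pos : 0 < h
  zero : radialH ρ lam τ m = 0
  upper : ∀ t, b ≤ t → t ≤ m → radialH ρ lam τ t ≤ -(ε * (t - b) * (m - t))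
  lower : ∀ t, m ≤ t → h * t * (t - m) ≤ radialH ρ lam τ t

lemma radialBounds_of_monotone {b m : ℝ} (hb : 0 < b) (hbm : b < m)
    (hτ : 0 ≤ τ) (hlam : lam ≤ 0 ∨ τ = 0) (hm : radialK ρ lam τ m = 0) :
    RadialBounds ρ lam τ b m 1 1 := by
  have hmono : ∀ s t, 0 < s → s ≤ t → radialK ρ lam τ s + (t - s) ≤ radialK ρ lam τ t := by
    intro s t hs hst
    have : lam * s ^ (-τ) ≤ lam * t ^ (-τ) := by
      rcases hlam with hlam | hτ0
      · exact mul_le_mul_of_nonpos_left (rpow_le_rpow_of_nonpos hs hst (by linarith)) hlam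
      · simp [hτ0]
    rw [radialK, radialK]
    linarith
  refine ⟨hb, hbm, one_pos, one_pos, ?_, fun t h1 h2 => ?_, fun t h1 => ?_⟩
  · rw [radialH_eq_mul (hb.trans hbm), hm, mul_zero]
  · have ht : 0 < t := hb.trans_le h1
    have := hmono t m ht h2
    rw [radialH_eq_mul ht]
    nlinarith
  · have ht : 0 < t := (hb.trans hbm).trans_le h1
    have := hmono m t (hb.trans hbm) h1
    rw [radialH_eq_mul ht]
    nlinarith

lemma exists_radialBounds_of_convex {a b c m : ℝ} (ha : 0 < a) (hab : a ≤ b) (hbm : b < m)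
    (hconv : ConvexOn ℝ (Set.Ioi 0) (radialK ρ lam τ)) (hKa : radialK ρ lam τ a = 0)
    (hm : radialK ρ lam τ m = 0) (hc0 : 0 < c) (hc : radialK ρ lam τ c < 0) :
    ∃ ε h, RadialBounds ρ lam τ b m ε h := by
  have ham : a < m := hab.trans_lt hbm
  have hm0 : 0 < m := ha.trans ham
  have three : ∀ x y z, 0 < x → x < y → y < z →
      radialK ρ lam τ y * (z - x) ≤ radialK ρ lam τ x * (z - y) + radialK ρ lam τ z * (y - x) := by
    intro x y z hx hxy hyz
    have := hconv.slope_mono_adjacent (Set.mem_Ioi.2 hx)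
      (Set.mem_Ioi.2 (hx.trans (hxy.trans hyz))) hxy hyz
    rw [div_le_div_iff₀ (by linarith) (by linarith)] at this
    linarith
  have hac : a < c := by
    by_contra hca
    rcases (not_lt.1 hca).eq_or_lt with h | h
    · rw [h] at hc; linarith
    · have := three c a m hc0 h ham
      rw [hKa, hm] at this
      nlinarith
  have hcm : c < m := by
    by_contra hca
    rcases (not_lt.1 hca).eq_or_lt with h | h
    · rw [← h] at hc; linarith
    · have := three a m c ha ham h
      rw [hKa, hm] at this
      nlinarith
  set κ := -radialK ρ lam τ c with hκ
  have hκ0 : 0 < κ := by linarith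
  have hK : ∀ t, a ≤ t → t ≤ m →
      radialK ρ lam τ t * (m - a) ^ 2 ≤ -(κ * (t - a) * (m - t)) := by
    intro t h1 h2
    rcases h1.eq_or_lt with h1 | h1
    · rw [← h1, hKa]; simp
    rcases h2.eq_or_lt with h2 | h2
    · rw [h2, hm]; simp
    rcases lt_trichotomy t c with htc | htc | htc
    · have := three a t c ha h1 htc
      rw [hKa, zero_mul, zero_add] at this
      have h3 : radialK ρ lam τ t * (m - a) ≤ radialK ρ lam τ c * (t - a) := by
        have hneg : radialK ρ lam τ t ≤ 0 := by
          by_contra hh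
          nlinarith
        nlinarith
      have h4 : radialK ρ lam τ t * (m - a) * (m - a)
          ≤ radialK ρ lam τ c * (t - a) * (m - a) :=
        mul_le_mul_of_nonneg_right h3 (by linarith)
      have h5 : 0 ≤ κ * (t - a) * (t - a) := by
        have : 0 < t - a := by linarith
        positivity
      nlinarith
    · rw [htc]
      have : (c - a) * (m - c) ≤ (m - a) ^ 2 := by nlinarith
      nlinarith
    · have := three c t m hc0 htc h2
      rw [hm, zero_mul, add_zero] at this
      have h3 : radialK ρ lam τ t * (m - a) ≤ radialK ρ lam τ c * (m - t) := by
        have hneg : radialK ρ lam τ t ≤ 0 := by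
          by_contra hh
          nlinarith
        nlinarith
      have h4 : radialK ρ lam τ t * (m - a) * (m - a)
          ≤ radialK ρ lam τ c * (m - t) * (m - a) :=
        mul_le_mul_of_nonneg_right h3 (by linarith)
      have h5 : 0 ≤ κ * (m - t) * (m - t) := by
        have : 0 < m - t := by linarith
        positivity
      nlinarith
  have hma : 0 < m - a := by linarith
  refine ⟨b * κ / (m - a) ^ 2, κ / (m - c), ha.trans_le hab, hbm, ?_,
    div_pos hκ0 (by linarith), ?_, fun t h1 h2 => ?_, fun t h1 => ?_⟩
  · have : 0 < b := ha.trans_le hab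
    positivity
  · rw [radialH_eq_mul hm0, hm, mul_zero]
  · have ht : 0 < t := (ha.trans_le hab).trans_le h1
    have hb : 0 < b := ha.trans_le hab
    have h3 := hK t (hab.trans h1) h2
    rw [radialH_eq_mul ht]
    have h4 : b * κ / (m - a) ^ 2 * (t - b) * (m - t) = b * (κ * (t - b) * (m - t)) / (m - a) ^ 2 := by
      ring
    rw [h4, le_neg, div_le_iff₀ (by positivity)]
    have h5 : κ * (t - b) * (m - t) ≤ κ * (t - a) * (m - t) := by
      have : 0 ≤ m - t := by linarith
      gcongr
    have h6 : 0 ≤ κ * (t - b) * (m - t) := by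
      have : 0 ≤ m - t := by linarith
      have : 0 ≤ t - b := by linarith
      positivity
    have h7 := mul_le_mul_of_nonneg_left h3 ht.le
    nlinarith
  · have ht : 0 < t := hm0.trans_le h1
    rw [radialH_eq_mul ht]
    rcases h1.eq_or_lt with h1 | h1
    · rw [← h1, hm]; simp
    have := three c m t hc0 hcm h1
    rw [hm, zero_mul] at this
    have h4 : κ / (m - c) * t * (t - m) = t * (κ * (t - m) / (m - c)) := by ring
    rw [h4]
    refine mul_le_mul_of_nonneg_left ?_ ht.le
    rw [div_le_iff₀ (by linarith)]
    linarith

end RadialH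

section PowerBound

lemma abs_rpow_sub_rpow_le {τ m : ℝ} (hτ0 : 0 ≤ τ) (hτ1 : τ < 1) (hm : 0 < m) {a : ℝ}
    (ha : 0 ≤ a) : |a ^ (1 - τ) - m ^ (1 - τ)| ≤ m ^ (-τ) * |a - m| := by
  obtain ⟨x, hx, rfl⟩ : ∃ x, 0 ≤ x ∧ a = m * x := ⟨a / m, by positivity, by field_simp⟩
  have h1 : |x ^ (1 - τ) - 1| ≤ |x - 1| := by
    rcases le_total 1 x with h | h
    · have a1 : 1 ≤ x ^ (1 - τ) := one_le_rpow h (by linarith)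
      have a2 : x ^ (1 - τ) ≤ x := by
        simpa using rpow_le_rpow_of_exponent_le h (by linarith : 1 - τ ≤ 1)
      rw [abs_of_nonneg (by linarith), abs_of_nonneg (by linarith)]
      linarith
    · have a1 : x ^ (1 - τ) ≤ 1 := rpow_le_one hx h (by linarith)
      have a2 : x ≤ x ^ (1 - τ) := by
        rcases hx.eq_or_lt with h0 | h0
        · rw [← h0]; positivity
        · simpa using rpow_le_rpow_of_exponent_ge h0 h (by linarith : 1 - τ ≤ 1)
      rw [abs_of_nonpos (by linarith), abs_of_nonpos (by linarith)]
      linarith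
  have h2 : m ^ (1 - τ) = m * m ^ (-τ) := by
    rw [sub_eq_add_neg, rpow_add hm, rpow_one]
  have h3 : 0 < m ^ (-τ) := rpow_pos_of_pos hm _
  rw [mul_rpow hm.le hx, h2,
    show m * m ^ (-τ) * x ^ (1 - τ) - m * m ^ (-τ) = m * m ^ (-τ) * (x ^ (1 - τ) - 1) by ring,
    show m * x - m = m * (x - 1) by ring, abs_mul, abs_mul, abs_mul, abs_of_pos hm, abs_of_pos h3]
  have := mul_le_mul_of_nonneg_left h1 (by positivity : 0 ≤ m * m ^ (-τ))
  linarith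

lemma radialH_add_le {ρ lam τ b : ℝ} (hτ0 : 0 ≤ τ) (hτ1 : τ < 1) (hb : 0 < b) (t : ℝ) :
    radialH ρ lam τ (b + t) ≤ radialH ρ lam τ b
      + (2 * b + 2 * |ρ| + |lam| * b ^ (-τ)) * |t| + t ^ 2 := by
  have h1 := abs_rpow_sub_rpow_le hτ0 hτ1 hb (abs_nonneg (b + t))
  have h2 : |(|b + t| - b)| ≤ |t| := by
    have := abs_abs_sub_abs_le_abs_sub (b + t) b
    rwa [abs_of_pos hb, add_sub_cancel_left] at this
  have h3 : lam * |b + t| ^ (1 - τ) - lam * b ^ (1 - τ) ≤ |lam| * b ^ (-τ) * |t| := by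
    calc lam * |b + t| ^ (1 - τ) - lam * b ^ (1 - τ)
        ≤ |lam * (|b + t| ^ (1 - τ) - b ^ (1 - τ))| := by
          rw [← mul_sub]; exact le_abs_self _
      _ = |lam| * |(|b + t| ^ (1 - τ) - b ^ (1 - τ))| := abs_mul _ _
      _ ≤ |lam| * (b ^ (-τ) * |t|) := by
          gcongr
          exact h1.trans (by gcongr)
      _ = _ := by ring
  have h4 : b * t ≤ b * |t| := by gcongr; exact le_abs_self t
  have h5 : -(ρ * t) ≤ |ρ| * |t| := by rw [← abs_mul]; exact neg_le_abs _
  rw [radialH, radialH, abs_of_pos hb]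
  nlinarith

end PowerBound

section Shell

variable {N : ℕ}

/-- The closed shell `a ≤ log ‖x‖ ≤ c`. -/
def shell (N : ℕ) (a c : ℝ) : Set (EuclideanSpace ℝ (Fin N)) :=
  {x | x ≠ 0 ∧ Real.log ‖x‖ ∈ Set.Icc a c}

lemma isCompact_shell (a c : ℝ) : IsCompact (shell N a c) := by
  have : shell N a c = Metric.closedBall 0 (Real.exp c) ∩ {x | Real.exp a ≤ ‖x‖} := by
    ext x
    simp only [shell, Set.mem_ofPred_eq, Set.mem_inter_iff, Metric.mem_closedBall,
      dist_zero_right, Set.mem_Icc]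
    constructor
    · rintro ⟨hx, h1, h2⟩
      have hx' := norm_pos_iff.2 hx
      exact ⟨(Real.log_le_iff_le_exp hx').1 h2, (Real.le_log_iff_exp_le hx').1 h1⟩
    · rintro ⟨h1, h2⟩
      have hx' : 0 < ‖x‖ := (Real.exp_pos a).trans_le h2
      exact ⟨norm_pos_iff.1 hx', (Real.le_log_iff_exp_le hx').2 h2,
        (Real.log_le_iff_le_exp hx').2 h1⟩
  rw [this]
  exact (isCompact_closedBall _ _).inter_right (isClosed_le continuous_const continuous_norm)

lemma continuousAt_log_norm {x : EuclideanSpace ℝ (Fin N)} (hx : x ≠ 0) :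
    ContinuousAt (fun y : EuclideanSpace ℝ (Fin N) => Real.log ‖y‖) x :=
  continuous_norm.continuousAt.log (norm_ne_zero_iff.2 hx)

lemma shell_mem_nhds {a c : ℝ} {x : EuclideanSpace ℝ (Fin N)} (hx : x ≠ 0)
    (h : Real.log ‖x‖ ∈ Set.Ioo a c) : shell N a c ∈ 𝓝 x := by
  filter_upwards [(isOpen_radial isOpen_Ioo).mem_nhds (⟨hx, h⟩ :
    x ∈ {x : EuclideanSpace ℝ (Fin N) | x ≠ 0 ∧ Real.log ‖x‖ ∈ Set.Ioo a c})] with y hy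
  exact ⟨hy.1, Set.Ioo_subset_Icc_self hy.2⟩

end Shell

section UpperBounds

variable {N : ℕ} {R : ℝ} {w : EuclideanSpace ℝ (Fin N) → ℝ}
  {p : EuclideanSpace ℝ (Fin N) → EuclideanSpace ℝ (Fin N)} {ρ lam τ θ q b m ε h : ℝ}

lemma isOpen_punctured : IsOpen (Metric.ball (0 : EuclideanSpace ℝ (Fin N)) R \ {0}) :=
  Metric.isOpen_ball.sdiff isClosed_singleton

lemma mem_punctured_iff (hR : 0 < R) {x : EuclideanSpace ℝ (Fin N)} :
    x ∈ Metric.ball (0 : EuclideanSpace ℝ (Fin N)) R \ {0} ↔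
      x ≠ 0 ∧ Real.log ‖x‖ < Real.log R := by
  rw [Set.mem_sdiff, mem_ball_zero_iff, Set.mem_singleton_iff, and_comm]
  refine and_congr_right fun hx => ?_
  rw [Real.log_lt_log_iff (norm_pos_iff.2 hx) hR]

lemma shell_subset_punctured (hR : 0 < R) {a c : ℝ} (hc : c < Real.log R) :
    shell N a c ⊆ Metric.ball (0 : EuclideanSpace ℝ (Fin N)) R \ {0} := fun _ hx =>
  (mem_punctured_iff hR).2 ⟨hx.1, hx.2.2.trans_lt hc⟩

/-- A Keller-Osserman type bound, which gains a factor `1 / L` over the scale-invariant one. -/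
lemma exists_exp_le_div (hR : 0 < R)
    (hw : WeakPoisson (Metric.ball 0 R \ {0}) w p (logRhs ρ lam τ θ q w p))
    (hbθ : θ + 2 = -((q - 1) * b)) (hq : 1 < q) (hτ0 : 0 ≤ τ) (hτ1 : τ < 1)
    (hb : 0 < b) (hH : radialH ρ lam τ b ≤ 0) :
    ∃ C, ∀ L, 1 ≤ L → ∀ x, x ≠ 0 → Real.log ‖x‖ + L < Real.log R →
      Real.exp ((q - 1) * (w x - b * Real.log ‖x‖)) ≤ C / L := by
  set k := 2 / (q - 1) with hk
  have hk0 : 0 < k := div_pos two_pos (by linarith)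
  have hkq : q - 1 = 2 / k := by
    rw [hk]; field_simp
  set A := 2 * b + 2 * |ρ| + |lam| * b ^ (-τ) with hA
  have hA0 : 0 ≤ A := by positivity
  refine ⟨4 * k + A * (2 * k) + 4 * k ^ 2, fun L hL x₀ hx₀ hx₀L => ?_⟩
  have hL0 : 0 < L := by linarith
  set c := Real.log ‖x₀‖ with hc
  set F : EuclideanSpace ℝ (Fin N) → ℝ := fun x =>
    Real.exp ((w x - b * Real.log ‖x‖) / k) * (1 - ((Real.log ‖x‖ - c) / L) ^ 2) with hF
  have hsub := shell_subset_punctured (N := N) hR (a := c - L) hx₀L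
  have hcl : ContinuousOn (fun x : EuclideanSpace ℝ (Fin N) => Real.log ‖x‖)
      (shell N (c - L) (c + L)) := fun x hx => (continuousAt_log_norm hx.1).continuousWithinAt
  have hFc : ContinuousOn F (shell N (c - L) (c + L)) :=
    (Real.continuous_exp.comp_continuousOn
      (((hw.continuousOn.mono hsub).sub (continuousOn_const.mul hcl)).div_const k)).mul
      (continuousOn_const.sub (((hcl.sub continuousOn_const).div_const L).pow 2))
  have hx₀s : x₀ ∈ shell N (c - L) (c + L) := ⟨hx₀, by constructor <;> linarith⟩
  obtain ⟨x, hx, hmax⟩ := (isCompact_shell (N := N) (c - L) (c + L)).exists_isMaxOn ⟨x₀, hx₀s⟩ hFc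
  have hF0 : F x₀ = Real.exp ((w x₀ - b * Real.log ‖x₀‖) / k) := by simp [hF, hc]
  have hFx : F x₀ ≤ F x := hmax hx₀s
  set X := (Real.log ‖x‖ - c) / L with hX
  have hD0 : 0 < 1 - X ^ 2 := by
    have h1 : 0 < F x := lt_of_lt_of_le (by rw [hF0]; positivity) hFx
    exact (pos_iff_pos_of_mul_pos h1).1 (Real.exp_pos _)
  set I : Set ℝ := {s | 0 < 1 - ((s - c) / L) ^ 2} with hI
  have hIo : IsOpen I := isOpen_lt continuous_const (by fun_prop)
  have hxI : Real.log ‖x‖ ∈ I := hD0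
  have hIIoo : ∀ s ∈ I, s ∈ Set.Ioo (c - L) (c + L) := by
    intro s hs
    have h1 : |(s - c) / L| < 1 := by
      rw [← sq_lt_one_iff_abs_lt_one]
      have : 0 < 1 - ((s - c) / L) ^ 2 := hs
      linarith
    rw [abs_lt, lt_div_iff₀ hL0, div_lt_iff₀ hL0] at h1
    constructor <;> linarith [h1.1, h1.2]
  have hlocF : IsLocalMax F x := hmax.isLocalMax (shell_mem_nhds hx.1 (hIIoo _ hxI))
  have hd0 : ∀ s, HasDerivAt (fun s : ℝ => (s - c) / L) (1 / L) s := fun s =>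
    ((hasDerivAt_id s).sub_const c).div_const L
  have hd1 : ∀ s, HasDerivAt (fun s : ℝ => 1 - ((s - c) / L) ^ 2) (-(2 * ((s - c) / L) / L)) s :=
    fun s => by
      convert! ((hd0 s).pow 2).const_sub 1 using 1
      simp
      ring
  have key := hw.exp_le_of_isLocalMax_radial isOpen_punctured hbθ hIo
    (φ := fun s => b * s - k * Real.log (1 - ((s - c) / L) ^ 2))
    (φ' := fun s => b + k * (2 * ((s - c) / L) / L) / (1 - ((s - c) / L) ^ 2))
    (φ'' := fun s => (2 * k / L ^ 2) * (1 + ((s - c) / L) ^ 2) / (1 - ((s - c) / L) ^ 2) ^ 2)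
    (fun s hs => by
      have hs' : (0 : ℝ) < 1 - ((s - c) / L) ^ 2 := hs
      have := ((hasDerivAt_id s).const_mul b).sub (((hd1 s).log hs'.ne').const_mul k)
      convert! this using 1
      ring)
    (fun s hs => by
      have hs' : (0 : ℝ) < 1 - ((s - c) / L) ^ 2 := hs
      have := (((((hd0 s).const_mul 2).div_const L).const_mul k).div (hd1 s) hs'.ne').const_add b
      convert! this using 1
      field_simp
      ring)
    (by
      refine ContinuousOn.div (by fun_prop) (by fun_prop) fun s hs => ?_
      have hs' : (0 : ℝ) < 1 - ((s - c) / L) ^ 2 := hs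
      positivity) (hsub hx) hx.1 hxI
    (by
      filter_upwards [hlocF, (isOpen_radial hIo).mem_nhds ⟨hx.1, hxI⟩] with y hy hyI
      have hyD : (0 : ℝ) < 1 - ((Real.log ‖y‖ - c) / L) ^ 2 := hyI.2
      have h1 := Real.log_le_log (by positivity) hy
      simp only [hF] at h1
      rw [Real.log_mul (Real.exp_pos _).ne' hyD.ne', Real.log_exp,
        Real.log_mul (Real.exp_pos _).ne' hD0.ne', Real.log_exp] at h1
      have h2 := mul_le_mul_of_nonneg_left h1 hk0.le
      rw [mul_add, mul_add, mul_div_cancel₀ _ hk0.ne', mul_div_cancel₀ _ hk0.ne'] at h2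
      linarith)
  simp only [← hX] at key
  have hD1 : 1 - X ^ 2 ≤ 1 := by nlinarith
  set D := 1 - X ^ 2 with hD
  have hX1 : |X| ≤ 1 := by
    rw [← sq_le_one_iff_abs_le_one]; linarith
  have hXsq : X ^ 2 ≤ 1 := by linarith
  have htabs : |k * (2 * X / L) / D| ≤ 2 * k / (L * D ^ 2) := by
    rw [abs_div _ D, abs_mul k, abs_div _ L, abs_mul 2 X, abs_of_pos hk0, abs_of_pos hL0,
      abs_of_pos hD0, abs_two, div_le_div_iff₀ hD0 (by positivity)]
    field_simp
    nlinarith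
  have htsq : (k * (2 * X / L) / D) ^ 2 ≤ 4 * k ^ 2 / (L * D ^ 2) := by
    rw [div_pow, div_le_div_iff₀ (by positivity) (by positivity)]
    field_simp
    nlinarith
  have hφ'' : 2 * k / L ^ 2 * (1 + X ^ 2) / D ^ 2 ≤ 4 * k / (L * D ^ 2) := by
    rw [div_le_div_iff₀ (by positivity) (by positivity)]
    field_simp
    nlinarith
  have hadd := radialH_add_le (ρ := ρ) (lam := lam) hτ0 hτ1 hb (k * (2 * X / L) / D)
  rw [← hA] at hadd
  have hAt := mul_le_mul_of_nonneg_left htabs hA0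
  have hfin : Real.exp ((q - 1) * (w x - b * Real.log ‖x‖)) * D ^ 2
      ≤ (4 * k + A * (2 * k) + 4 * k ^ 2) / L := by
    rw [← le_div_iff₀ (by positivity), div_div]
    calc _ ≤ 4 * k / (L * D ^ 2) + (A * (2 * k / (L * D ^ 2)) + 4 * k ^ 2 / (L * D ^ 2)) := by
          linarith
      _ = _ := by ring
  have hsq : ∀ y : EuclideanSpace ℝ (Fin N), Real.exp ((q - 1) * (w y - b * Real.log ‖y‖))
      = Real.exp ((w y - b * Real.log ‖y‖) / k) ^ 2 := fun y => by
    rw [← Real.exp_nat_mul, hkq]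
    congr 1
    push_cast
    ring
  rw [hsq, ← mul_pow] at hfin
  rw [hsq, ← hF0]
  have hF00 : 0 ≤ F x₀ := by rw [hF0]; positivity
  exact (pow_le_pow_left₀ hF00 hFx 2).trans hfin

end UpperBounds

section Comparison

variable {N : ℕ} {R : ℝ} {w : EuclideanSpace ℝ (Fin N) → ℝ}
  {p : EuclideanSpace ℝ (Fin N) → EuclideanSpace ℝ (Fin N)} {ρ lam τ θ q b m ε h : ℝ}

/-- The maximum of `w - m log ‖x‖` on punctured balls is attained on the boundary sphere. -/
lemma sub_log_le_of_sphere (hR : 0 < R)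
    (hw : WeakPoisson (Metric.ball 0 R \ {0}) w p (logRhs ρ lam τ θ q w p))
    (hbθ : θ + 2 = -((q - 1) * b)) (hq : 1 < q) (hτ0 : 0 ≤ τ) (hτ1 : τ < 1)
    (hB : RadialBounds ρ lam τ b m ε h) {s₀ κ : ℝ} (hs₀ : s₀ < Real.log R)
    (hκ : ∀ y, y ≠ 0 → Real.log ‖y‖ = s₀ → w y - m * Real.log ‖y‖ ≤ κ) :
    ∀ x, x ≠ 0 → Real.log ‖x‖ ≤ s₀ → w x - m * Real.log ‖x‖ ≤ κ := by
  intro x₀ hx₀ hx₀s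
  have hHb : radialH ρ lam τ b ≤ 0 := by simpa using hB.upper b le_rfl hB.b_lt.le
  obtain ⟨C, hC⟩ := exists_exp_le_div hR hw hbθ hq hτ0 hτ1 hB.b_pos hHb
  have hε := hB.ε_pos
  have hδ : 0 < m - b := by linarith [hB.b_lt]
  set a := Real.exp (ε * (m - b) * Real.log ‖x₀‖) with ha
  have ha0 : 0 < a := Real.exp_pos _
  have main : ∀ K, 0 < K → w x₀ - m * Real.log ‖x₀‖ ≤ κ + 1 / (ε * K * a) := by
    intro K hK
    set φ : ℝ → ℝ := fun s =>
      b * s + 1 / ε * Real.log (1 + K * Real.exp (ε * (m - b) * s)) with hφ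
    have hpos : ∀ s, 0 < 1 + K * Real.exp (ε * (m - b) * s) := fun s => by positivity
    have hφge : ∀ s, b * s ≤ φ s := fun s => by
      have : 0 ≤ Real.log (1 + K * Real.exp (ε * (m - b) * s)) :=
        Real.log_nonneg (by have : 0 < K * Real.exp (ε * (m - b) * s) := by positivity
                            linarith)
      have : 0 ≤ 1 / ε * Real.log (1 + K * Real.exp (ε * (m - b) * s)) := by positivity
      simp only [hφ]
      linarith
    have hE : ∀ s, HasDerivAt (fun s => Real.exp (ε * (m - b) * s))
        (Real.exp (ε * (m - b) * s) * (ε * (m - b))) s := fun s => by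
      simpa using ((hasDerivAt_id s).const_mul (ε * (m - b))).exp
    have hφ1 : ∀ s ∈ Set.univ, HasDerivAt φ ((fun s => b + (m - b) *
        (K * Real.exp (ε * (m - b) * s) / (1 + K * Real.exp (ε * (m - b) * s)))) s) s := by
      intro s _
      have := ((hasDerivAt_id s).const_mul b).add
        (((((hE s).const_mul K).const_add 1).log (hpos s).ne').const_mul (1 / ε))
      convert! this using 1
      have := (hpos s).ne'
      field_simp
    have hφ2 : ∀ s ∈ Set.univ, HasDerivAt (fun s => b + (m - b) *
        (K * Real.exp (ε * (m - b) * s) / (1 + K * Real.exp (ε * (m - b) * s))))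
        ((fun s => ε * (m - b) ^ 2 * (K * Real.exp (ε * (m - b) * s)) /
          (1 + K * Real.exp (ε * (m - b) * s)) ^ 2) s) s := by
      intro s _
      have := (((((hE s).const_mul K).div (((hE s).const_mul K).const_add 1)
        (hpos s).ne')).const_mul (m - b)).const_add b
      convert! this using 1
      have := (hpos s).ne'
      field_simp
      ring
    have hφ3 : ContinuousOn (fun s => ε * (m - b) ^ 2 * (K * Real.exp (ε * (m - b) * s)) /
          (1 + K * Real.exp (ε * (m - b) * s)) ^ 2) Set.univ := by
      refine ContinuousOn.div (by fun_prop) (by fun_prop) fun s _ => ?_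
      have := hpos s
      positivity
    have hnomax : ∀ x ∈ Metric.ball (0 : EuclideanSpace ℝ (Fin N)) R \ {0},
        ¬ IsLocalMax (fun y => w y - φ (Real.log ‖y‖)) x := by
      intro x hx hmax
      have h1 := hw.exp_le_of_isLocalMax_radial isOpen_punctured hbθ isOpen_univ hφ1 hφ2 hφ3 hx
        hx.2 trivial hmax
      set T := K * Real.exp (ε * (m - b) * Real.log ‖x‖) with hT
      have hT0 : 0 < T := by positivity
      have h2 : T / (1 + T) ≤ 1 := by rw [div_le_one (by linarith)]; linarith
      have h3 : 0 ≤ T / (1 + T) := by positivity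
      have h4 := hB.upper (b + (m - b) * (T / (1 + T))) (by nlinarith) (by nlinarith)
      have h5 : ε * (b + (m - b) * (T / (1 + T)) - b) * (m - (b + (m - b) * (T / (1 + T))))
          = ε * (m - b) ^ 2 * T / (1 + T) ^ 2 := by
        field_simp
        ring
      have h6 := Real.exp_pos ((q - 1) * (w x - b * Real.log ‖x‖))
      linarith
    have hupper : w x₀ - φ (Real.log ‖x₀‖) ≤ κ + m * s₀ - φ s₀ := by
      set y₀ := w x₀ - φ (Real.log ‖x₀‖) with hy₀
      set L := max 1 (max (2 * C / Real.exp ((q - 1) * y₀)) (Real.log R - Real.log ‖x₀‖ + 1))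
        with hL
      have hL1 : 1 ≤ L := le_max_left _ _
      have hL2 : 2 * C / Real.exp ((q - 1) * y₀) ≤ L := (le_max_left _ _).trans (le_max_right _ _)
      have hL3 : Real.log R - Real.log ‖x₀‖ + 1 ≤ L := (le_max_right _ _).trans (le_max_right _ _)
      set s₁ := Real.log R - L - 1 with hs₁
      have hlow : ∀ y, y ≠ 0 → Real.log ‖y‖ = s₁ → w y - φ (Real.log ‖y‖) < y₀ := by
        intro y hy hys
        have h1 := hC L hL1 y hy (by rw [hys]; linarith)
        have h2 : C / L < Real.exp ((q - 1) * y₀) := by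
          rw [div_le_iff₀ (Real.exp_pos _)] at hL2
          rw [div_lt_iff₀ (by linarith)]
          have : 0 < Real.exp ((q - 1) * y₀) * L := by
            have : 0 < L := by linarith
            positivity
          linarith
        have h3 := Real.exp_lt_exp.1 (h1.trans_lt h2)
        have h4 := lt_of_mul_lt_mul_left h3 (by linarith)
        linarith [hφge (Real.log ‖y‖)]
      have hsub := shell_subset_punctured (N := N) hR (a := s₁) hs₀
      have hcl : ContinuousOn (fun x : EuclideanSpace ℝ (Fin N) => Real.log ‖x‖)
          (shell N s₁ s₀) := fun x hx => (continuousAt_log_norm hx.1).continuousWithinAt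
      have hφc : Continuous φ := continuous_iff_continuousAt.2 fun s => (hφ1 s trivial).continuousAt
      have hx₀m : x₀ ∈ shell N s₁ s₀ := ⟨hx₀, by linarith, hx₀s⟩
      obtain ⟨x, hx, hmax⟩ := (isCompact_shell (N := N) s₁ s₀).exists_isMaxOn ⟨x₀, hx₀m⟩
        ((hw.continuousOn.mono hsub).sub (hφc.comp_continuousOn hcl))
      have hge : y₀ ≤ w x - φ (Real.log ‖x‖) := hmax hx₀m
      rcases hx.2.1.eq_or_lt with h1 | h1
      · exact absurd (hlow x hx.1 h1.symm) (not_lt.2 hge)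
      rcases hx.2.2.eq_or_lt with h2 | h2
      · have := hκ x hx.1 h2
        rw [h2] at this hge
        linarith
      · exact absurd (hmax.isLocalMax (shell_mem_nhds hx.1 ⟨h1, h2⟩)) (hnomax x (hsub hx))
    have hlog1 : Real.log (1 + K * a) ≤ Real.log K + ε * (m - b) * Real.log ‖x₀‖ + 1 / (K * a) := by
      have h1 : 1 + K * a = K * a * (1 + 1 / (K * a)) := by field_simp; ring
      have h2 : Real.log (1 + 1 / (K * a)) ≤ 1 / (K * a) := by
        have := Real.log_le_sub_one_of_pos (by positivity : 0 < 1 + 1 / (K * a))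
        linarith
      rw [h1, Real.log_mul (by positivity) (by positivity), Real.log_mul hK.ne' ha0.ne', ha,
        Real.log_exp]
      rw [ha] at h2
      linarith
    have hlog2 : Real.log K + ε * (m - b) * s₀
        ≤ Real.log (1 + K * Real.exp (ε * (m - b) * s₀)) := by
      rw [← Real.log_exp (ε * (m - b) * s₀), ← Real.log_mul hK.ne' (Real.exp_pos _).ne',
        Real.log_exp]
      exact Real.log_le_log (by positivity) (by linarith)
    have h5 : 1 / ε * Real.log (1 + K * a) - 1 / ε * Real.log (1 + K * Real.exp (ε * (m - b) * s₀))
        ≤ (m - b) * (Real.log ‖x₀‖ - s₀) + 1 / (ε * K * a) := by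
      have : 1 / ε * (Real.log (1 + K * a) - Real.log (1 + K * Real.exp (ε * (m - b) * s₀)))
        ≤ 1 / ε * (ε * (m - b) * (Real.log ‖x₀‖ - s₀) + 1 / (K * a)) := by
        gcongr
        linarith
      rw [mul_sub] at this
      convert this using 1
      field_simp
    simp only [hφ] at hupper
    linarith
  refine le_of_forall_pos_le_add fun η hη => ?_
  have := main (1 / (ε * a * η)) (by positivity)
  have e : 1 / (ε * (1 / (ε * a * η)) * a) = η := by field_simp
  rwa [e] at this

/-- A lower bound for `w - m log ‖x‖` on punctured balls in terms of its boundary values. -/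
lemma le_sub_log_of_sphere (hR : 0 < R)
    (hw : WeakPoisson (Metric.ball 0 R \ {0}) w p (logRhs ρ lam τ θ q w p))
    (hbθ : θ + 2 = -((q - 1) * b)) (hq : 1 < q)
    (hB : RadialBounds ρ lam τ b m ε h) {s₀ s₁ κ C K : ℝ} (hs₀ : s₀ < Real.log R) (hs : s₀ ≤ s₁)
    (hC : ∀ y, y ≠ 0 → Real.log ‖y‖ ≤ s₁ → w y - m * Real.log ‖y‖ ≤ C)
    (hK : Real.exp ((q - 1) * C) < K * ((q - 1) * (m - b)) ^ 2)
    (hκ : ∀ y, y ≠ 0 → Real.log ‖y‖ = s₀ → κ ≤ w y - m * Real.log ‖y‖) :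
    ∀ x, x ≠ 0 → Real.log ‖x‖ ≤ s₀ →
      κ - K * Real.exp ((q - 1) * (m - b) * s₀) ≤ w x - m * Real.log ‖x‖ := by
  intro x₀ hx₀ hx₀s
  have hh := hB.h_pos
  have hm : 0 < m := hB.b_pos.trans hB.b_lt
  set η := (q - 1) * (m - b) with hη
  have hη0 : 0 < η := mul_pos (by linarith) (by linarith [hB.b_lt])
  have hK0 : 0 < K := by
    have := (Real.exp_pos _).trans hK
    exact (pos_iff_pos_of_mul_pos this).2 (by positivity)
  have main : ∀ S, -S < Real.log ‖x₀‖ →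
      κ - K * Real.exp (η * s₀) + 1 / h * Real.log (1 - Real.exp (-(h * m) * (Real.log ‖x₀‖ + S)))
        ≤ w x₀ - m * Real.log ‖x₀‖ := by
    intro S hS
    set E : ℝ → ℝ := fun s => Real.exp (-(h * m) * (s + S)) with hE
    have hE1 : ∀ s, -S < s → E s < 1 := fun s hs => by
      rw [hE]
      refine Real.exp_lt_one_iff.2 ?_
      have : 0 < h * m * (s + S) := by
        have : 0 < s + S := by linarith
        positivity
      linarith
    have hEd : ∀ s, HasDerivAt E (-(h * m) * E s) s := fun s => by
      have := (((hasDerivAt_id s).add_const S).const_mul (-(h * m))).exp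
      convert! this using 1
      simp only [hE]
      simp
      ring
    have hX : ∀ s, HasDerivAt (fun s => Real.exp (η * s)) (η * Real.exp (η * s)) s := fun s => by
      have := ((hasDerivAt_id s).const_mul η).exp
      convert! this using 1
      simp
      ring
    have hEc : Continuous E := by fun_prop
    set φ : ℝ → ℝ := fun s => m * s + 1 / h * Real.log (1 - E s) + K * Real.exp (η * s) with hφ
    have hφ1 : ∀ s ∈ Set.Ioi (-S), HasDerivAt φ
        ((fun s => m / (1 - E s) + K * (η * Real.exp (η * s))) s) s := by
      intro s hs
      have h1 : (1 : ℝ) - E s ≠ 0 := by linarith [hE1 s hs]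
      have := ((((hasDerivAt_id s).const_mul m).add
        ((((hEd s).const_sub 1).log h1).const_mul (1 / h))).add ((hX s).const_mul K))
      convert! this using 1
      field_simp
      ring
    have hφ2 : ∀ s ∈ Set.Ioi (-S), HasDerivAt (fun s => m / (1 - E s) + K * (η * Real.exp (η * s)))
        ((fun s => -(h * m ^ 2 * E s / (1 - E s) ^ 2) + K * (η ^ 2 * Real.exp (η * s))) s) s := by
      intro s hs
      have h1 : (1 : ℝ) - E s ≠ 0 := by linarith [hE1 s hs]
      have := (((hasDerivAt_const s m).div ((hEd s).const_sub 1) h1)).add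
        (((hX s).const_mul η).const_mul K)
      convert! this using 1
      field_simp
      ring
    have hφ3 : ContinuousOn (fun s => -(h * m ^ 2 * E s / (1 - E s) ^ 2)
        + K * (η ^ 2 * Real.exp (η * s))) (Set.Ioi (-S)) := by
      refine ContinuousOn.add (ContinuousOn.neg (ContinuousOn.div (by fun_prop) (by fun_prop)
        fun s hs => ?_)) (by fun_prop)
      have : 0 < 1 - E s := by linarith [hE1 s hs]
      positivity
    have hnomin : ∀ x, x ≠ 0 → Real.log ‖x‖ ≤ s₀ → -S < Real.log ‖x‖ →
        ¬ IsLocalMin (fun y => w y - φ (Real.log ‖y‖)) x := by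
      intro x hx hxs hxS hmin
      have h1 := hw.le_exp_of_isLocalMin_radial isOpen_punctured hbθ isOpen_Ioi hφ1 hφ2 hφ3
        ((mem_punctured_iff hR).2 ⟨hx, hxs.trans_lt hs₀⟩) hx hxS hmin
      have hE0 : 0 < E (Real.log ‖x‖) := Real.exp_pos _
      have hE1' := hE1 _ hxS
      set e := E (Real.log ‖x‖) with he
      set X := Real.exp (η * Real.log ‖x‖) with hXdef
      have hX0 : 0 < X := Real.exp_pos _
      have he1 : 0 < 1 - e := by linarith
      have h2 : m / (1 - e) - m = m * e / (1 - e) := by field_simp; ring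
      have h2' : 0 < m * e / (1 - e) := by positivity
      have h3 : 0 < K * (η * X) := by positivity
      have h4 := hB.lower (m / (1 - e) + K * (η * X)) (by linarith)
      have h5 : h * (m / (1 - e)) * (m * e / (1 - e)) ≤
          h * (m / (1 - e) + K * (η * X)) * (m / (1 - e) + K * (η * X) - m) := by
        have : 0 < m / (1 - e) := by positivity
        refine mul_le_mul ?_ (by linarith) h2'.le (by positivity)
        exact mul_le_mul_of_nonneg_left (by linarith) hh.le
      have h6 : h * (m / (1 - e)) * (m * e / (1 - e)) = h * m ^ 2 * e / (1 - e) ^ 2 := by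
        field_simp
      have h7 : K * (η ^ 2 * X) ≤ Real.exp ((q - 1) * (w x - b * Real.log ‖x‖)) := by linarith
      have h8 : Real.exp ((q - 1) * (w x - b * Real.log ‖x‖)) ≤ Real.exp ((q - 1) * C) * X := by
        rw [hXdef, ← Real.exp_add, Real.exp_le_exp]
        have := hC x hx (hxs.trans hs)
        have : (q - 1) * (w x - m * Real.log ‖x‖) ≤ (q - 1) * C :=
          mul_le_mul_of_nonneg_left this (by linarith)
        rw [hη]
        linarith
      have h9 : Real.exp ((q - 1) * C) * X < K * η ^ 2 * X := mul_lt_mul_of_pos_right hK hX0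
      linarith
    set G : EuclideanSpace ℝ (Fin N) → ℝ := fun x => (1 - E (Real.log ‖x‖)) *
      Real.exp (-(h * (w x - m * Real.log ‖x‖ - K * Real.exp (η * Real.log ‖x‖)))) with hG
    have hGeq : ∀ x, -S < Real.log ‖x‖ → G x = Real.exp (-(h * (w x - φ (Real.log ‖x‖)))) := by
      intro x hx
      have h1 : 0 < 1 - E (Real.log ‖x‖) := by linarith [hE1 _ hx]
      simp only [hG, hφ]
      nth_rewrite 1 [← Real.exp_log h1]
      rw [← Real.exp_add]
      congr 1
      field_simp
      ring
    have hsub := shell_subset_punctured (N := N) hR (a := -S) hs₀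
    have hcl : ContinuousOn (fun x : EuclideanSpace ℝ (Fin N) => Real.log ‖x‖)
        (shell N (-S) s₀) := fun x hx => (continuousAt_log_norm hx.1).continuousWithinAt
    have hGc : ContinuousOn G (shell N (-S) s₀) := by
      refine (continuousOn_const.sub (hEc.comp_continuousOn hcl)).mul
        (Real.continuous_exp.comp_continuousOn (ContinuousOn.neg (continuousOn_const.mul ?_)))
      exact ((hw.continuousOn.mono hsub).sub (continuousOn_const.mul hcl)).sub
        (continuousOn_const.mul (Real.continuous_exp.comp_continuousOn
          (continuousOn_const.mul hcl)))
    have hx₀m : x₀ ∈ shell N (-S) s₀ := ⟨hx₀, hS.le, hx₀s⟩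
    obtain ⟨x, hx, hmax⟩ := (isCompact_shell (N := N) (-S) s₀).exists_isMaxOn ⟨x₀, hx₀m⟩ hGc
    have hge : G x₀ ≤ G x := hmax hx₀m
    rcases hx.2.1.eq_or_lt with h1 | h1
    · exfalso
      have : G x = 0 := by simp [hG, hE, ← h1]
      rw [this, hGeq x₀ hS] at hge
      exact absurd hge (not_le.2 (Real.exp_pos _))
    rcases hx.2.2.eq_or_lt with h2 | h2
    · rw [hGeq x₀ hS, hGeq x h1, Real.exp_le_exp, neg_le_neg_iff] at hge
      have h3 := le_of_mul_le_mul_left hge hh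
      have h4 := hκ x hx.1 h2
      have h5 : 1 / h * Real.log (1 - E (Real.log ‖x‖)) ≤ 0 := by
        refine mul_nonpos_of_nonneg_of_nonpos (by positivity) (Real.log_nonpos ?_ ?_)
        · linarith [hE1 _ h1]
        · have : 0 < E (Real.log ‖x‖) := Real.exp_pos _
          linarith
      have h6 : 0 < K * Real.exp (η * Real.log ‖x₀‖) := by positivity
      simp only [hφ] at h3
      rw [h2] at h3 h4 h5
      linarith
    · refine absurd ?_ (hnomin x hx.1 hx.2.2 h1)
      filter_upwards [hmax.isLocalMax (shell_mem_nhds hx.1 ⟨h1, h2⟩),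
        shell_mem_nhds hx.1 ⟨h1, h2⟩, (isOpen_radial (isOpen_Ioi (a := -S))).mem_nhds ⟨hx.1, h1⟩]
        with y hy _ hyS
      rw [hGeq y hyS.2, hGeq x h1, Real.exp_le_exp, neg_le_neg_iff] at hy
      exact le_of_mul_le_mul_left hy hh
  have hlim : Tendsto (fun S => κ - K * Real.exp (η * s₀)
      + 1 / h * Real.log (1 - Real.exp (-(h * m) * (Real.log ‖x₀‖ + S)))) atTop
      (𝓝 (κ - K * Real.exp (η * s₀) + 1 / h * Real.log (1 - 0))) := by
    refine Tendsto.const_add _ (Tendsto.const_mul _ (Tendsto.log (Tendsto.const_sub _ ?_)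
      (by norm_num)))
    refine Real.tendsto_exp_atBot.comp ?_
    have : 0 < h * m := mul_pos hh hm
    exact (tendsto_atTop_add_const_left _ _ tendsto_id).const_mul_atTop_of_neg (by linarith)
  rw [sub_zero, Real.log_one, mul_zero, add_zero] at hlim
  refine le_of_tendsto hlim ?_
  filter_upwards [eventually_gt_atTop (-Real.log ‖x₀‖)] with S hS
  exact main S (by linarith)

end Comparison

section GradientBound

variable {N : ℕ} {U : Set (EuclideanSpace ℝ (Fin N))} {u g : EuclideanSpace ℝ (Fin N) → ℝ}
  {p : EuclideanSpace ℝ (Fin N) → EuclideanSpace ℝ (Fin N)}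

/-- Interior gradient estimate for a right-hand side that grows linearly in the gradient. -/
lemma WeakPoisson.norm_grad_le_of_growth (hU : IsOpen U) (hu : WeakPoisson U u p g) {d A M : ℝ}
    {z : EuclideanSpace ℝ (Fin N)} (hd : 0 < d) (hA : 0 ≤ A)
    (hball : Metric.closedBall z d ⊆ U)
    (hg : ∀ x ∈ Metric.closedBall z d, |g x| ≤ A * (‖p x‖ / d + M / d ^ 2))
    (hM : ∀ x ∈ Metric.closedBall z d, |u x| ≤ M) :
    ‖p z‖ ≤ (1 + 4 * N * (A + 1)) * M / d := by
  have hz : z ∈ Metric.closedBall z d := by simp [hd.le]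
  have hM0 : 0 ≤ M := (abs_nonneg _).trans (hM z hz)
  obtain ⟨y, hy, hmax⟩ := (isCompact_closedBall z d).exists_isMaxOn ⟨z, hz⟩
    (f := fun x => (d - dist x z) * ‖p x‖)
    ((continuousOn_const.sub (continuous_id.dist continuous_const).continuousOn).mul
      (hu.cont_grad.mono hball).norm)
  rw [le_div_iff₀ hd, mul_comm _ d]
  have hzy : d * ‖p z‖ ≤ (d - dist y z) * ‖p y‖ := by simpa using hmax hz
  refine hzy.trans ?_
  set s := d - dist y z with hs
  have hs0 : 0 ≤ s := by have := Metric.mem_closedBall.1 hy; linarith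
  have hsd : s ≤ d := by have := dist_nonneg (x := y) (y := z); linarith
  rcases hs0.eq_or_lt with h0 | hs0
  · rw [← h0, zero_mul]
    positivity
  set Q := s * ‖p y‖ with hQ
  have hQ0 : 0 ≤ Q := by positivity
  set k := 1 / (2 * (A + 1)) with hk
  have hk0 : 0 < k := by positivity
  have hkA : 2 * (A + 1) * k = 1 := by rw [hk]; field_simp
  have hk2 : k ≤ 1 / 2 := by nlinarith
  have hsub : Metric.closedBall y (k * s) ⊆ Metric.closedBall z d := fun x hx => by
    rw [Metric.mem_closedBall] at hx ⊢
    have := dist_triangle x y z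
    nlinarith
  have hpx : ∀ x ∈ Metric.closedBall y (k * s), ‖p x‖ ≤ 2 * Q / s := fun x hx => by
    have h1 : (d - dist x z) * ‖p x‖ ≤ Q := hmax (hsub hx)
    have h2 : s / 2 ≤ d - dist x z := by
      rw [Metric.mem_closedBall] at hx
      have := dist_triangle x y z
      nlinarith
    rw [le_div_iff₀ hs0]
    nlinarith [norm_nonneg (p x)]
  have hgx : ∀ x ∈ Metric.closedBall y (k * s), |g x| ≤ A * ((2 * Q + M) / s ^ 2) := fun x hx => by
    refine (hg x (hsub hx)).trans (mul_le_mul_of_nonneg_left ?_ hA)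
    have h1 : ‖p x‖ / d ≤ 2 * Q / s / s := div_le_div₀ (by positivity) (hpx x hx) hs0 hsd
    have h2 : M / d ^ 2 ≤ M / s ^ 2 := by gcongr
    have h3 : (2 * Q + M) / s ^ 2 = 2 * Q / s / s + M / s ^ 2 := by field_simp
    linarith
  have h1 := hu.norm_grad_le hU (by positivity : 0 < k * s) (hsub.trans hball) hgx
    fun x hx => hM x (hsub hx)
  have h2 : Q ≤ A * k * Q + A * k * M / 2 + N * M / k := by
    calc Q = s * ‖p y‖ := rfl
      _ ≤ s * (A * ((2 * Q + M) / s ^ 2) * (k * s) / 2 + N * M / (k * s)) := by gcongr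
      _ = A * k * Q + A * k * M / 2 + N * M / k := by field_simp
  have h3 : N * M / k = 2 * (A + 1) * N * M := by rw [hk]; field_simp
  rw [h3] at h2
  have h4 : A * k ≤ 1 / 2 := by nlinarith
  nlinarith [mul_le_mul_of_nonneg_right h4 hQ0, mul_le_mul_of_nonneg_right h4 hM0]

lemma rpow_mul_rpow_one_sub_le_add {τ a c : ℝ} (hτ0 : 0 ≤ τ) (hτ1 : τ < 1) (ha : 0 ≤ a)
    (hc : 0 ≤ c) : a ^ τ * c ^ (1 - τ) ≤ a + c := by
  have := geom_mean_le_arith_mean2_weighted hτ0 (by linarith : 0 ≤ 1 - τ) ha hc (by ring)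
  nlinarith

lemma rpow_eq_exp_of_add_two {θ q b x : ℝ} (hx : 0 < x) (hbθ : θ + 2 = -((q - 1) * b)) :
    x ^ θ = Real.exp (-((q - 1) * b) * Real.log x) / x ^ 2 := by
  rw [← hbθ, mul_comm, ← rpow_def_of_pos hx, rpow_add hx, rpow_two]
  field_simp

/-- Scale-invariant bound for the logarithmic gradient of a solution comparable to `‖x‖ ^ m`. -/
lemma IsSolutionE.exists_norm_mul_norm_grad_le {ρ lam τ θ q b m R V : ℝ}
    {Ω : Set (EuclideanSpace ℝ (Fin N))}
    (hΩ : IsOpen Ω) (hu : IsSolutionE N ρ lam τ θ q Ω u) (hτ0 : 0 ≤ τ) (hτ1 : τ < 1)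
    (hq : 1 < q) (hbθ : θ + 2 = -((q - 1) * b)) (hm : 0 < m) (hbm : b < m)
    (hRΩ : Metric.ball 0 R ⊆ Ω)
    (hV : ∀ x ∈ Metric.ball 0 R \ {0}, |Real.log (u x) - m * Real.log ‖x‖| ≤ V) :
    ∃ G, ∀ x, x ≠ 0 → ‖x‖ < R / 2 → ‖x‖ * ‖(u x)⁻¹ • gradient u x‖ ≤ G := by
  set C₂ := Real.exp ((q - 1) * (V + (m - b) * Real.log R)) with hC₂
  set A := |(N : ℝ) - 2 + 2 * ρ| + |lam| + C₂ with hA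
  have hC₂0 : 0 < C₂ := Real.exp_pos _
  have hA0 : 0 ≤ A := by positivity
  set C := 1 + 4 * N * (A + 1) with hC
  have hC0 : 0 ≤ C := by positivity
  refine ⟨2 * C * Real.exp (2 * V + m * (Real.log 3 - Real.log 2)), fun z hz hzR => ?_⟩
  have hzn : 0 < ‖z‖ := norm_pos_iff.2 hz
  obtain ⟨d, hd, hzd⟩ : ∃ d, 0 < d ∧ ‖z‖ = 2 * d := ⟨‖z‖ / 2, by positivity, by ring⟩
  have hlow : ∀ y ∈ Metric.closedBall z d, d ≤ ‖y‖ := fun y hy => by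
    have h1 := norm_sub_norm_le z y
    rw [Metric.mem_closedBall, dist_comm, dist_eq_norm] at hy
    linarith
  have hupp : ∀ y ∈ Metric.closedBall z d, ‖y‖ ≤ 3 * d := fun y hy => by
    have h1 := norm_sub_norm_le y z
    rw [Metric.mem_closedBall, dist_eq_norm] at hy
    linarith
  have hball : Metric.closedBall z d ⊆ Metric.ball 0 R \ {0} := fun y hy => by
    refine ⟨mem_ball_zero_iff.2 ((hupp y hy).trans_lt (by linarith)), ?_⟩
    exact norm_pos_iff.1 (hd.trans_le (hlow y hy))
  have hsub : Metric.ball 0 R \ {0} ⊆ Ω \ {0} := Set.sdiff_subset_sdiff_left hRΩ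
  set M := Real.exp (V + m * Real.log (3 * d)) with hM
  have hpos : ∀ y ∈ Metric.closedBall z d, 0 < u y := fun y hy => hu.1.2 y (hsub (hball hy))
  have huM : ∀ y ∈ Metric.closedBall z d, u y ≤ M := fun y hy => by
    rw [← Real.log_le_iff_le_exp (hpos y hy)]
    have h1 := (abs_le.1 (hV y (hball hy))).2
    have h2 := Real.log_le_log (hd.trans_le (hlow y hy)) (hupp y hy)
    nlinarith
  have hest := (hu.weakPoisson hΩ hτ1).norm_grad_le_of_growth (hΩ.sdiff isClosed_singleton)
    (A := A) (M := M) hd hA0 (hball.trans hsub) (fun y hy => ?_)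
    fun y hy => by rw [abs_of_pos (hpos y hy)]; exact huM y hy
  · have hzm : z ∈ Metric.closedBall z d := by simp [hd.le]
    have hMu : M ≤ Real.exp (2 * V + m * (Real.log 3 - Real.log 2)) * u z := by
      rw [← Real.exp_log (hpos z hzm), ← Real.exp_add, hM]
      have h1 := (abs_le.1 (hV z (hball hzm))).1
      rw [hzd, Real.log_mul two_ne_zero hd.ne'] at h1
      rw [Real.log_mul three_ne_zero hd.ne', Real.exp_le_exp]
      nlinarith
    rw [norm_smul, norm_inv, norm_of_nonneg (hpos z hzm).le, hzd]
    have : 2 * d * ((u z)⁻¹ * ‖gradient u z‖) ≤ 2 * d * ((u z)⁻¹ * (C * M / d)) := by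
      have := hpos z hzm
      gcongr
    refine this.trans ?_
    have hup := hpos z hzm
    have e : 2 * d * ((u z)⁻¹ * (C * M / d)) = 2 * C * (M / u z) := by field_simp
    rw [e]
    gcongr
    rwa [div_le_iff₀ hup]
  · have hyd := hlow y hy
    have hy0 : 0 < ‖y‖ := hd.trans_le hyd
    have hup := hpos y hy
    have huM' := huM y hy
    have h1 : |((N : ℝ) - 2 + 2 * ρ) * (⟪y, gradient u y⟫ / ‖y‖ ^ 2)|
        ≤ |(N : ℝ) - 2 + 2 * ρ| * (‖gradient u y‖ / d) := by
      rw [abs_mul]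
      gcongr
      rw [abs_div, abs_of_pos (by positivity : 0 < ‖y‖ ^ 2)]
      calc |⟪y, gradient u y⟫| / ‖y‖ ^ 2 ≤ ‖y‖ * ‖gradient u y‖ / ‖y‖ ^ 2 := by
            gcongr
            exact abs_real_inner_le_norm _ _
        _ = ‖gradient u y‖ / ‖y‖ := by field_simp
        _ ≤ ‖gradient u y‖ / d := by gcongr
    have h2 : |lam * Gt τ y (u y) (gradient u y)|
        ≤ |lam| * (‖gradient u y‖ / d + M / d ^ 2) := by
      rw [abs_mul]
      gcongr
      rw [Gt, abs_of_nonneg (by positivity)]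
      calc u y ^ τ * ‖gradient u y‖ ^ (1 - τ) / ‖y‖ ^ (τ + 1)
          = (u y / ‖y‖) ^ τ * ‖gradient u y‖ ^ (1 - τ) / ‖y‖ := by
            rw [div_rpow hup.le hy0.le, rpow_add_one hy0.ne']
            field_simp
        _ ≤ (u y / ‖y‖ + ‖gradient u y‖) / ‖y‖ := by
            gcongr
            exact rpow_mul_rpow_one_sub_le_add hτ0 hτ1 (by positivity) (norm_nonneg _)
        _ ≤ (M / d + ‖gradient u y‖) / d := by gcongr
        _ = ‖gradient u y‖ / d + M / d ^ 2 := by field_simp; ring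
    have h3 : |‖y‖ ^ θ * u y ^ q| ≤ C₂ * (M / d ^ 2) := by
      rw [abs_of_nonneg (by positivity), rpow_eq_exp_of_add_two hy0 hbθ]
      have e : u y ^ q = u y * Real.exp ((q - 1) * Real.log (u y)) := by
        rw [mul_comm (q - 1), ← rpow_def_of_pos hup, rpow_sub_one hup.ne']
        field_simp
      have e2 : Real.exp (-((q - 1) * b) * Real.log ‖y‖) * Real.exp ((q - 1) * Real.log (u y))
          ≤ C₂ := by
        rw [← Real.exp_add, hC₂, Real.exp_le_exp]
        have a1 := (abs_le.1 (hV y (hball hy))).2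
        have a2 := Real.log_le_log hy0 (mem_ball_zero_iff.1 (hball hy).1).le
        have a3 : (m - b) * Real.log ‖y‖ ≤ (m - b) * Real.log R :=
          mul_le_mul_of_nonneg_left a2 (by linarith)
        have a4 : (q - 1) * (Real.log (u y) - b * Real.log ‖y‖)
            ≤ (q - 1) * (V + (m - b) * Real.log R) :=
          mul_le_mul_of_nonneg_left (by linarith) (by linarith)
        linarith
      calc Real.exp (-((q - 1) * b) * Real.log ‖y‖) / ‖y‖ ^ 2 * u y ^ q
          = Real.exp (-((q - 1) * b) * Real.log ‖y‖) * Real.exp ((q - 1) * Real.log (u y))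
              * (u y / ‖y‖ ^ 2) := by rw [e]; ring
        _ ≤ C₂ * (M / d ^ 2) := by gcongr
    have hgn : 0 ≤ ‖gradient u y‖ / d := by positivity
    have hMn : 0 ≤ M / d ^ 2 := by positivity
    calc _ ≤ |((N : ℝ) - 2 + 2 * ρ) * (⟪y, gradient u y⟫ / ‖y‖ ^ 2)|
          + |lam * Gt τ y (u y) (gradient u y)| + |‖y‖ ^ θ * u y ^ q| :=
          (abs_add_le _ _).trans (by gcongr; exact abs_sub _ _)
      _ ≤ _ := by
          rw [hA]
          nlinarith [mul_nonneg (abs_nonneg ((N : ℝ) - 2 + 2 * ρ)) hMn, mul_nonneg hC₂0.le hgn]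

end GradientBound

section Growth

variable {N : ℕ} {U S : Set (EuclideanSpace ℝ (Fin N))} {D g : EuclideanSpace ℝ (Fin N) → ℝ}
  {P : EuclideanSpace ℝ (Fin N) → EuclideanSpace ℝ (Fin N)}

/-- The factor lost when a lower bound is propagated from a ball to the ball of twice its radius. -/
def growthConst (N : ℕ) (K : ℝ) : ℝ :=
  Real.exp (-((2 * N + 8 * K + 1) / 4) * 4) - Real.exp (-((2 * N + 8 * K + 1) / 4) * 16)

lemma growthConst_pos {K : ℝ} (hK : 0 ≤ K) : 0 < growthConst N K := by
  have : (0 : ℝ) < 2 * N + 8 * K + 1 := by positivity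
  rw [growthConst, sub_pos, Real.exp_lt_exp]
  linarith

/-- Growth lemma: propagation of positivity for supersolutions. -/
lemma WeakPoisson.growthConst_mul_le (hU : IsOpen U) (hD : WeakPoisson U D P g) {a K κ : ℝ}
    {z : EuclideanSpace ℝ (Fin N)} (ha : 0 < a) (hK : 0 ≤ K) (hκ : 0 < κ)
    (hball : Metric.closedBall z (4 * a) ⊆ U)
    (hg : ∀ x ∈ Metric.closedBall z (4 * a), g x ≤ K / a * ‖P x‖)
    (h0 : ∀ x ∈ Metric.closedBall z (4 * a), 0 ≤ D x)
    (h1 : ∀ x ∈ Metric.closedBall z a, κ ≤ D x) :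
    ∀ x ∈ Metric.closedBall z (2 * a), growthConst N K * κ ≤ D x := by
  set μ := (2 * N + 8 * K + 1) / 4 with hμ
  have hμ0 : 0 < μ := by positivity
  set c := Real.exp (-μ * 16) with hc
  set f : ℝ → ℝ := fun t => κ * (Real.exp (-μ / a ^ 2 * t) - c) with hf
  have hE : ∀ t, HasDerivAt (fun t => Real.exp (-μ / a ^ 2 * t))
      (Real.exp (-μ / a ^ 2 * t) * (-μ / a ^ 2)) t := fun t => by
    simpa using ((hasDerivAt_id t).const_mul (-μ / a ^ 2)).exp
  have hess := (hasHessianOn_norm_sub_sq (s := Set.univ) z).comp_real (f := f)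
    (f' := fun t => κ * (Real.exp (-μ / a ^ 2 * t) * (-μ / a ^ 2)))
    (f'' := fun t => κ * (Real.exp (-μ / a ^ 2 * t) * (-μ / a ^ 2) * (-μ / a ^ 2)))
    (fun x _ => ((hE _).sub_const c).const_mul κ)
    (fun x _ => ((hE _).mul_const _).const_mul κ) (by fun_prop)
  have hfc : Continuous fun x : EuclideanSpace ℝ (Fin N) => f (‖x - z‖ ^ 2) := by
    simp only [hf]; fun_prop
  suffices key : ∀ x ∈ Metric.closedBall z (4 * a), f (‖x - z‖ ^ 2) ≤ D x by
    intro x hx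
    refine le_trans ?_ (key x (Metric.closedBall_subset_closedBall (by linarith) hx))
    rw [Metric.mem_closedBall, dist_eq_norm] at hx
    rw [growthConst, mul_comm]
    refine mul_le_mul_of_nonneg_left (sub_le_sub_right (Real.exp_le_exp.2 ?_) _) hκ.le
    have : ‖x - z‖ ^ 2 ≤ (2 * a) ^ 2 := by gcongr
    rw [div_mul_eq_mul_div, le_div_iff₀ (by positivity)]
    nlinarith
  obtain ⟨y, hy, hmin⟩ := (isCompact_closedBall z (4 * a)).exists_isMinOn
    ⟨z, by simp [ha.le]⟩ (f := fun x => D x - f (‖x - z‖ ^ 2))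
    ((hD.continuousOn.mono hball).sub hfc.continuousOn)
  by_contra! hcon
  obtain ⟨x, hx, hlt⟩ := hcon
  have hyneg : D y < f (‖y - z‖ ^ 2) := by
    have : D y - f (‖y - z‖ ^ 2) ≤ D x - f (‖x - z‖ ^ 2) := hmin hx
    linarith
  have hy4 : ‖y - z‖ < 4 * a := by
    refine lt_of_le_of_ne (by simpa [dist_eq_norm] using hy) fun h => ?_
    have e : f (‖y - z‖ ^ 2) = 0 := by
      rw [h]
      simp only [hf, hc]
      rw [show -μ / a ^ 2 * (4 * a) ^ 2 = -μ * 16 by field_simp; ring, sub_self, mul_zero]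
    linarith [h0 y hy]
  have hy1 : a < ‖y - z‖ := by
    by_contra! h
    have h2 := h1 y (by simpa [dist_eq_norm] using h)
    have h3 : f (‖y - z‖ ^ 2) ≤ κ * 1 := by
      simp only [hf]
      gcongr
      have : Real.exp (-μ / a ^ 2 * ‖y - z‖ ^ 2) ≤ 1 := by
        rw [Real.exp_le_one_iff, neg_div, neg_mul]
        have : 0 ≤ μ / a ^ 2 * ‖y - z‖ ^ 2 := by positivity
        linarith
      linarith [Real.exp_pos (-μ * 16)]
    linarith
  have hloc : IsLocalMin (fun x => D x - f (‖x - z‖ ^ 2)) y := by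
    refine hmin.isLocalMin (Filter.mem_of_superset (Metric.isOpen_ball.mem_nhds ?_)
      Metric.ball_subset_closedBall)
    simpa [dist_eq_norm] using hy4
  have hyU := hball hy
  have t1 := hD.trace_le_of_isLocalMin hU isOpen_univ hess hyU (Set.mem_univ y) hloc
  have t2 := hD.grad_eq_of_isLocalExtr hess hyU (Set.mem_univ y) (Or.inl hloc)
  have t3 := hg y hy
  rw [t2] at t3
  set E := Real.exp (-μ / a ^ 2 * ‖y - z‖ ^ 2) with hEdef
  have hE0 : 0 < E := Real.exp_pos _
  rw [euclTrace_add, euclTrace_smul, euclTrace_smul, euclTrace_smul, euclTrace_id,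
    euclTrace_smulRight, norm_smul, norm_of_nonneg (by norm_num : (0 : ℝ) ≤ 2)] at t1
  rw [norm_smul, norm_smul, norm_of_nonneg (by norm_num : (0 : ℝ) ≤ 2),
    show κ * (E * (-μ / a ^ 2)) = -(κ * (E * (μ / a ^ 2))) by ring, norm_neg,
    norm_of_nonneg (by positivity)] at t3
  have t4 := t1.trans t3
  set r := ‖y - z‖ / a with hr
  have hr1 : 1 < r := by rwa [hr, one_lt_div ha]
  have hr4 : r < 4 := by rwa [hr, div_lt_iff₀ ha]
  have hrz : ‖y - z‖ = r * a := by rw [hr]; field_simp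
  rw [hrz] at t4
  have hB : 0 < κ * E * μ / a ^ 2 := by positivity
  have t5 : κ * E * μ / a ^ 2 * (4 * μ * r ^ 2 - 2 * N) ≤ κ * E * μ / a ^ 2 * (K * 2 * r) := by
    have e1 : κ * (E * (-μ / a ^ 2)) * (2 * N) + κ * (E * (-μ / a ^ 2) * (-μ / a ^ 2))
        * (2 * (r * a)) ^ 2 = κ * E * μ / a ^ 2 * (4 * μ * r ^ 2 - 2 * N) := by
      field_simp
      ring
    have e2 : K / a * (κ * (E * (μ / a ^ 2)) * (2 * (r * a))) = κ * E * μ / a ^ 2 * (K * 2 * r) := by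
      field_simp
    rwa [e1, e2] at t4
  have t6 := le_of_mul_le_mul_left t5 hB
  have t7 : 4 * μ = 2 * N + 8 * K + 1 := by rw [hμ]; ring
  have t8 : 4 * μ * 1 ≤ 4 * μ * r ^ 2 := by gcongr; nlinarith
  nlinarith

lemma WeakPoisson.growthConst_pow_mul_le_of_segment (hU : IsOpen U) (hD : WeakPoisson U D P g)
    {a K κ : ℝ} {n : ℕ} {y y' : EuclideanSpace ℝ (Fin N)} (ha : 0 < a) (hK : 0 ≤ K) (hκ : 0 < κ)
    (hn : 0 < n) (hSU : S ⊆ U) (hg : ∀ x ∈ S, g x ≤ K / a * ‖P x‖) (h0 : ∀ x ∈ S, 0 ≤ D x)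
    (hS : ∀ t ∈ Set.Icc (0 : ℝ) 1, Metric.closedBall (y + t • (y' - y)) (4 * a) ⊆ S)
    (hyy : ‖y' - y‖ ≤ n * a) (h1 : ∀ x ∈ Metric.closedBall y a, κ ≤ D x) :
    ∀ x ∈ Metric.closedBall y' a, growthConst N K ^ n * κ ≤ D x := by
  have hn0 : (0 : ℝ) < n := by exact_mod_cast hn
  have key : ∀ k : ℕ, k ≤ n → ∀ x ∈ Metric.closedBall (y + ((k : ℝ) / n) • (y' - y)) a,
      growthConst N K ^ k * κ ≤ D x := by
    intro k
    induction k with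
    | zero => simpa using h1
    | succ k ih =>
      intro hk x hx
      have hk' : ((k : ℝ) / n) ∈ Set.Icc (0 : ℝ) 1 :=
        ⟨by positivity, by rw [div_le_one hn0]; exact_mod_cast (Nat.le_of_succ_le hk)⟩
      have hsub := hS _ hk'
      have hpos : 0 < growthConst N K ^ k * κ := mul_pos (pow_pos (growthConst_pos hK) k) hκ
      rw [pow_succ', mul_assoc]
      refine hD.growthConst_mul_le hU ha hK hpos (hsub.trans hSU) (fun x hx => hg x (hsub hx))
        (fun x hx => h0 x (hsub hx)) (ih (Nat.le_of_succ_le hk)) x ?_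
      rw [Metric.mem_closedBall, dist_eq_norm] at hx ⊢
      have e : x - (y + ((k : ℝ) / n) • (y' - y))
          = (x - (y + (((k + 1 : ℕ) : ℝ) / n) • (y' - y))) + (1 / (n : ℝ)) • (y' - y) := by
        push_cast
        module
      rw [e]
      refine (norm_add_le _ _).trans ?_
      have : ‖(1 / (n : ℝ)) • (y' - y)‖ ≤ a := by
        rw [norm_smul, norm_of_nonneg (by positivity), one_div, inv_mul_le_iff₀ hn0]
        exact hyy
      linarith
  have := key n le_rfl
  rw [div_self hn0.ne', one_smul, add_sub_cancel] at this
  exact this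

lemma exists_norm_eq_inner_nonneg (hN : 2 ≤ N) (z x : EuclideanSpace ℝ (Fin N)) {r : ℝ}
    (hr : 0 < r) : ∃ e : EuclideanSpace ℝ (Fin N), ‖e‖ = r ∧ ⟪z, e⟫ = 0 ∧ 0 ≤ ⟪e, x⟫ := by
  have hne : (ℝ ∙ z)ᗮ ≠ ⊥ := fun h => by
    rw [Submodule.orthogonal_eq_bot_iff] at h
    have h1 := finrank_span_le_card (R := ℝ) ({z} : Set (EuclideanSpace ℝ (Fin N)))
    rw [Set.toFinset_singleton, Finset.card_singleton, h, finrank_top, finrank_euclideanSpace_fin] at h1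
    omega
  obtain ⟨e, he, he0⟩ := Submodule.exists_mem_ne_zero_of_ne_bot hne
  have hze : ⟪z, e⟫ = 0 := Submodule.mem_orthogonal_singleton_iff_inner_right.1 he
  have hen : ‖e‖ ≠ 0 := norm_ne_zero_iff.2 he0
  rcases le_total 0 ⟪e, x⟫ with h | h
  · refine ⟨(r / ‖e‖) • e, ?_, ?_, ?_⟩
    · rw [norm_smul, norm_of_nonneg (by positivity)]; field_simp
    · rw [inner_smul_right, hze, mul_zero]
    · rw [real_inner_smul_left]; positivity
  · refine ⟨(-(r / ‖e‖)) • e, ?_, ?_, ?_⟩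
    · rw [norm_smul, norm_neg, norm_of_nonneg (by positivity)]; field_simp
    · rw [inner_smul_right, hze, mul_zero]
    · rw [real_inner_smul_left]
      exact mul_nonneg_of_nonpos_of_nonpos (neg_nonpos.2 (by positivity)) h

lemma norm_segment_mem_Icc {y y' : EuclideanSpace ℝ (Fin N)} {r t : ℝ} (hy : ‖y‖ = r)
    (hy' : ‖y'‖ = r) (hi : 0 ≤ ⟪y, y'⟫) (ht : t ∈ Set.Icc (0 : ℝ) 1) :
    ‖y + t • (y' - y)‖ ∈ Set.Icc (r / 2) r := by
  have hr : 0 ≤ r := hy ▸ norm_nonneg y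
  have e : y + t • (y' - y) = (1 - t) • y + t • y' := by module
  have h1 : ‖y + t • (y' - y)‖ ^ 2 = ((1 - t) ^ 2 + t ^ 2) * r ^ 2 + 2 * (t * (1 - t)) * ⟪y, y'⟫ := by
    rw [e, norm_add_sq_real, norm_smul, norm_smul, inner_smul_right, real_inner_smul_left, hy, hy',
      mul_pow, mul_pow, norm_eq_abs, norm_eq_abs, sq_abs, sq_abs]
    ring
  have h2 : ⟪y, y'⟫ ≤ r ^ 2 := by
    have := real_inner_le_norm y y'
    rwa [hy, hy', ← sq] at this
  have ht_nonneg : 0 ≤ t * (1 - t) := mul_nonneg ht.1 (by linarith [ht.2])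
  constructor
  · refine le_of_sq_le_sq ?_ (norm_nonneg _)
    rw [h1]
    nlinarith [mul_nonneg ht_nonneg hi, sq_nonneg (2 * t - 1), sq_nonneg r,
      mul_nonneg (sq_nonneg (2 * t - 1)) (sq_nonneg r)]
  · refine le_of_sq_le_sq ?_ hr
    rw [h1]
    nlinarith [mul_le_mul_of_nonneg_left h2 ht_nonneg]

/-- Propagation of positivity along a sphere centred at the origin. -/
lemma WeakPoisson.growthConst_pow_mul_le_of_sphere (hN : 2 ≤ N) (hU : IsOpen U)
    (hD : WeakPoisson U D P g) {a K κ r : ℝ} {n : ℕ} {x z : EuclideanSpace ℝ (Fin N)} (ha : 0 < a)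
    (hK : 0 ≤ K) (hκ : 0 < κ) (har : 16 * a ≤ r) (hn : 2 * r ≤ n * a)
    (hSU : ∀ y, r / 4 ≤ ‖y‖ → ‖y‖ ≤ 2 * r → y ∈ U)
    (hg : ∀ y, r / 4 ≤ ‖y‖ → ‖y‖ ≤ 2 * r → g y ≤ K / a * ‖P y‖)
    (h0 : ∀ y, r / 4 ≤ ‖y‖ → ‖y‖ ≤ 2 * r → 0 ≤ D y)
    (hz : ‖z‖ = r) (hx : ‖x‖ = r) (h1 : ∀ y ∈ Metric.closedBall z a, κ ≤ D y) :
    growthConst N K ^ n * (growthConst N K ^ n * κ) ≤ D x := by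
  have hr : 0 < r := by linarith
  have hn0 : 0 < n := by
    have : (0 : ℝ) < n := pos_of_mul_pos_left (lt_of_lt_of_le (by linarith) hn) ha.le
    exact_mod_cast this
  obtain ⟨e, he, hze, hex⟩ := exists_norm_eq_inner_nonneg hN z x hr
  have seg : ∀ y y' : EuclideanSpace ℝ (Fin N), ∀ κ' : ℝ, 0 < κ' → ‖y‖ = r → ‖y'‖ = r →
      0 ≤ ⟪y, y'⟫ → (∀ x ∈ Metric.closedBall y a, κ' ≤ D x) →
      ∀ x ∈ Metric.closedBall y' a, growthConst N K ^ n * κ' ≤ D x := by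
    intro y y' κ' hκ' hy hy' hi hl
    refine hD.growthConst_pow_mul_le_of_segment hU (S := {y | r / 4 ≤ ‖y‖ ∧ ‖y‖ ≤ 2 * r}) ha hK hκ'
      hn0 (fun y hy => hSU y hy.1 hy.2) (fun y hy => hg y hy.1 hy.2) (fun y hy => h0 y hy.1 hy.2)
      (fun t ht x hx => ?_) ?_ hl
    · have h2 := norm_segment_mem_Icc hy hy' hi ht
      rw [Metric.mem_closedBall, dist_eq_norm] at hx
      have h3 := norm_sub_norm_le x (y + t • (y' - y))
      have h4 := norm_sub_norm_le (y + t • (y' - y)) x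
      rw [norm_sub_rev] at h4
      exact ⟨by linarith [h2.1], by linarith [h2.2]⟩
    · refine (norm_sub_le _ _).trans ?_
      rw [hy, hy']
      linarith
  have hc := pow_pos (growthConst_pos (N := N) hK) n
  exact seg e x _ (mul_pos hc hκ) he hx hex (seg z e κ hκ hz he hze.ge h1) x
    (by simp [ha.le])

end Growth

section Limit

variable {N : ℕ} {R : ℝ} {v g : EuclideanSpace ℝ (Fin N) → ℝ}
  {p : EuclideanSpace ℝ (Fin N) → EuclideanSpace ℝ (Fin N)}

lemma WeakPoisson.abs_sub_le_of_norm_grad_le {U : Set (EuclideanSpace ℝ (Fin N))}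
    (hv : WeakPoisson U v p g) {z : EuclideanSpace ℝ (Fin N)} {a C : ℝ}
    (hball : Metric.closedBall z a ⊆ U) (hC : ∀ x ∈ Metric.closedBall z a, ‖p x‖ ≤ C)
    {y : EuclideanSpace ℝ (Fin N)} (hy : y ∈ Metric.closedBall z a) : |v y - v z| ≤ C * a := by
  have ha : 0 ≤ a := dist_nonneg.trans hy
  have hz : z ∈ Metric.closedBall z a := Metric.mem_closedBall_self ha
  have h1 := (convex_closedBall z a).norm_image_sub_le_of_norm_hasFDerivWithin_le
    (fun x hx => (hv.grad x (hball hx)).hasFDerivAt.hasFDerivWithinAt)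
    (fun x hx => by rw [LinearIsometryEquiv.norm_map]; exact hC x hx) hz hy
  rw [norm_eq_abs] at h1
  refine h1.trans (mul_le_mul_of_nonneg_left ?_ ((norm_nonneg _).trans (hC z hz)))
  rwa [← dist_eq_norm]

lemma eventually_punctured {r : ℝ} (hr : 0 < r) : ∀ᶠ x in 𝓝[≠] (0 : EuclideanSpace ℝ (Fin N)),
    x ≠ 0 ∧ ‖x‖ < r := by
  filter_upwards [self_mem_nhdsWithin, mem_nhdsWithin_of_mem_nhds (Metric.ball_mem_nhds 0 hr)]
    with x h1 h2
  exact ⟨h1, mem_ball_zero_iff.1 h2⟩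

/-- A bounded supersolution whose maxima over punctured balls are attained on the boundary has a
limit at the origin. -/
lemma WeakPoisson.exists_tendsto (hN : 2 ≤ N) (hR : 0 < R)
    (hv : WeakPoisson (Metric.ball 0 R \ {0}) v p g) {V G K : ℝ} (hK : 0 ≤ K)
    (hV : ∀ x ∈ Metric.ball 0 R \ {0}, |v x| ≤ V)
    (hG : ∀ x ∈ Metric.ball 0 R \ {0}, ‖x‖ * ‖p x‖ ≤ G)
    (hg : ∀ x ∈ Metric.ball 0 R \ {0}, -(K / ‖x‖ * ‖p x‖) ≤ g x)
    (hmax : ∀ s κ, s < Real.log R → (∀ y, y ≠ 0 → Real.log ‖y‖ = s → v y ≤ κ) →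
      ∀ x, x ≠ 0 → Real.log ‖x‖ ≤ s → v x ≤ κ) :
    ∃ A, Tendsto v (𝓝[≠] 0) (𝓝 A) := by
  obtain ⟨x₁, hx₁n⟩ : ∃ x : EuclideanSpace ℝ (Fin N), ‖x‖ = 1 := by
    obtain ⟨e, he, -⟩ := exists_norm_eq_inner_nonneg hN (0 : EuclideanSpace ℝ (Fin N)) 0 one_pos
    exact ⟨e, he⟩
  set T := {κ : ℝ | ∃ s < Real.log R, ∀ x, x ≠ 0 → Real.log ‖x‖ ≤ s → v x ≤ κ} with hT
  have hTbdd : BddBelow T := by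
    refine ⟨-V, ?_⟩
    rintro κ ⟨s, hs, h⟩
    have e : ‖Real.exp s • x₁‖ = Real.exp s := by
      rw [norm_smul, hx₁n, mul_one, norm_of_nonneg (Real.exp_pos s).le]
    have hx0 : Real.exp s • x₁ ≠ 0 := norm_pos_iff.1 (by rw [e]; exact Real.exp_pos s)
    have hlog : Real.log ‖Real.exp s • x₁‖ = s := by rw [e, Real.log_exp]
    refine le_trans ?_ (h _ hx0 hlog.le)
    exact (abs_le.1 (hV _ ((mem_punctured_iff hR).2 ⟨hx0, by rwa [hlog]⟩))).1
  have hTne : T.Nonempty := by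
    refine ⟨V, Real.log R - 1, by linarith, fun x hx hxs => ?_⟩
    exact (abs_le.1 (hV _ ((mem_punctured_iff hR).2 ⟨hx, by linarith⟩))).2
  set A := sInf T with hA
  have hlarge : ∀ ε > 0, ∀ r, 0 < r → r < R → ∃ x : EuclideanSpace ℝ (Fin N), ‖x‖ = r ∧
      A - ε ≤ v x := by
    intro ε hε r hr hrR
    by_contra! hcon
    have hs := Real.log_lt_log hr hrR
    have hmem : A - ε ∈ T := ⟨Real.log r, hs, hmax _ _ hs fun y hy hys =>
      (hcon y (Real.log_injOn_pos (norm_pos_iff.2 hy) hr hys)).le⟩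
    linarith [csInf_le hTbdd hmem]
  have hsmall : ∀ ε > 0, ∃ r₀, 0 < r₀ ∧ r₀ < R ∧ ∀ x, x ≠ 0 → ‖x‖ ≤ r₀ → v x ≤ A + ε := by
    intro ε hε
    obtain ⟨κ, ⟨s, hs, hκ⟩, hlt⟩ := exists_lt_of_csInf_lt hTne (by linarith : A < A + ε)
    refine ⟨Real.exp s, Real.exp_pos s, (Real.lt_log_iff_exp_lt hR).1 hs, fun x hx hxs => ?_⟩
    exact (hκ x hx ((Real.log_le_iff_le_exp (norm_pos_iff.2 hx)).2 hxs)).trans hlt.le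
  have hG0 : 0 ≤ G := by
    have hx : ‖(R / 2) • x₁‖ = R / 2 := by
      rw [norm_smul, hx₁n, mul_one, norm_of_nonneg (by positivity)]
    refine le_trans (by positivity) (hG ((R / 2) • x₁) ⟨?_, ?_⟩)
    · rw [mem_ball_zero_iff, hx]; linarith
    · exact norm_pos_iff.1 (by rw [hx]; positivity)
  refine ⟨A, Metric.tendsto_nhds.2 fun κ hκ => ?_⟩
  set σ := min (1 / 16) (κ / 2 / (4 * (G + 1))) with hσ
  have hσ0 : 0 < σ := lt_min (by norm_num) (by positivity)
  have hσ16 : σ ≤ 1 / 16 := min_le_left _ _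
  have hσG : 4 * (G + 1) * σ ≤ κ / 2 := by
    have := min_le_right (1 / 16) (κ / 2 / (4 * (G + 1)))
    rwa [← hσ, le_div_iff₀ (by positivity), mul_comm] at this
  obtain ⟨n, hn⟩ := exists_nat_ge (2 / σ)
  rw [div_le_iff₀ hσ0] at hn
  set c := growthConst N (4 * K * σ) ^ n with hc
  have hc0 : 0 < c := pow_pos (growthConst_pos (by positivity)) n
  set ε := min (κ / 2) (c * (c * (κ / 4)) / 4) with hε
  have hε0 : 0 < ε := lt_min (by positivity) (by positivity)
  have hεκ : ε ≤ κ / 2 := min_le_left _ _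
  have hεc : ε ≤ c * (c * (κ / 4)) / 4 := min_le_right _ _
  obtain ⟨r₀, hr₀, hr₀R, hup⟩ := hsmall ε hε0
  filter_upwards [eventually_punctured (half_pos hr₀)] with z hz
  have hz0 : 0 < ‖z‖ := norm_pos_iff.2 hz.1
  have hzr := hz.2
  rw [Real.dist_eq, abs_lt]
  refine ⟨?_, by linarith [hup z hz.1 (by linarith)]⟩
  by_contra! hcon
  obtain ⟨r, hr⟩ : ∃ r, r = ‖z‖ := ⟨_, rfl⟩
  rw [← hr] at hz0 hzr
  obtain ⟨x, hxr, hxA⟩ := hlarge ε hε0 r hz0 (by linarith)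
  have hmem : ∀ y : EuclideanSpace ℝ (Fin N), r / 4 ≤ ‖y‖ → ‖y‖ ≤ 2 * r →
      y ∈ Metric.ball (0 : EuclideanSpace ℝ (Fin N)) R \ {0} := fun y h1 h2 =>
    ⟨mem_ball_zero_iff.2 (by linarith), norm_pos_iff.1 (by linarith)⟩
  have hconst : WeakPoisson (Metric.ball (0 : EuclideanSpace ℝ (Fin N)) R \ {0})
      (fun _ => A + ε) (fun _ => 0) (fun _ => 0) :=
    ⟨fun x _ => hasGradientAt_const x _, continuousOn_const, continuousOn_const, by simp⟩
  have hD := hconst.sub isOpen_punctured hv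
  have hb : ∀ y ∈ Metric.closedBall z (σ * r), r / 2 ≤ ‖y‖ ∧ ‖y‖ ≤ 2 * r := fun y hy => by
    rw [Metric.mem_closedBall, dist_eq_norm] at hy
    have h1 := norm_sub_norm_le y z
    have h2 := norm_sub_norm_le z y
    rw [norm_sub_rev] at h2
    rw [← hr] at h1 h2
    constructor <;> nlinarith
  have hzb : ∀ y ∈ Metric.closedBall z (σ * r), κ / 4 ≤ A + ε - v y := fun y hy => by
    have h1 := hv.abs_sub_le_of_norm_grad_le (C := 2 * G / r)
      (fun y hy => hmem y (by linarith [(hb y hy).1]) (hb y hy).2) (fun y hy => ?_) hy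
    · have h2 : 2 * G / r * (σ * r) = 2 * G * σ := by field_simp
      rw [h2] at h1
      have h3 := (abs_le.1 h1).2
      nlinarith
    · have h1 := hb y hy
      have h2 := hG y (hmem y (by linarith) h1.2)
      rw [le_div_iff₀ hz0]
      nlinarith [norm_nonneg (p y)]
  have key := hD.growthConst_pow_mul_le_of_sphere hN isOpen_punctured (a := σ * r) (K := 4 * K * σ)
    (κ := κ / 4) (r := r) (n := n) (x := x) (z := z) (by positivity) (by positivity)
    (by positivity) (by nlinarith) (by nlinarith) hmem (fun y h1 h2 => ?_)
    (fun y h1 h2 => ?_) hr.symm hxr hzb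
  · rw [← hc] at key
    have : 0 < c * (c * (κ / 4)) := by positivity
    linarith
  · have h3 := hg y (hmem y h1 h2)
    rw [zero_sub, zero_sub, norm_neg]
    have hy0 : 0 < ‖y‖ := by linarith
    have h4 : K / ‖y‖ ≤ 4 * K * σ / (σ * r) := by
      rw [div_le_div_iff₀ hy0 (by positivity)]
      have : σ * r * K ≤ σ * (4 * ‖y‖) * K := by gcongr; linarith
      linarith
    have h5 := mul_le_mul_of_nonneg_right h4 (norm_nonneg (p y))
    linarith
  · have hy0 : 0 < ‖y‖ := by linarith
    have := hup y (norm_pos_iff.1 hy0) (by linarith)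
    linarith

/-- The scale-invariant gradient vanishes at a point where the function has a limit. -/
lemma WeakPoisson.tendsto_norm_mul_norm_grad (hR : 0 < R)
    (hv : WeakPoisson (Metric.ball 0 R \ {0}) v p g) {K A : ℝ}
    (hg : ∀ x ∈ Metric.ball 0 R \ {0}, |g x| ≤ K / ‖x‖ ^ 2) (hA : Tendsto v (𝓝[≠] 0) (𝓝 A)) :
    Tendsto (fun x => ‖x‖ * ‖p x‖) (𝓝[≠] 0) (𝓝 0) := by
  refine Metric.tendsto_nhds.2 fun κ hκ => ?_
  set K' := max K 0 with hK'
  have hK'0 : 0 ≤ K' := le_max_right _ _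
  set σ := min (1 / 2) (κ / (4 * (K' + 1))) with hσ
  have hσ0 : 0 < σ := lt_min (by norm_num) (by positivity)
  have hσ2 : σ ≤ 1 / 2 := min_le_left _ _
  have hσK : 4 * (K' + 1) * σ ≤ κ := by
    have := min_le_right (1 / 2) (κ / (4 * (K' + 1)))
    rwa [← hσ, le_div_iff₀ (by positivity), mul_comm] at this
  set ε := σ * κ / (4 * (N + 1)) with hε
  have hε0 : 0 < ε := by positivity
  have h1 := (Metric.tendsto_nhds.1 hA) ε hε0
  rw [eventually_nhdsWithin_iff, Metric.eventually_nhds_iff] at h1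
  obtain ⟨r₁, hr₁, h1⟩ := h1
  filter_upwards [eventually_punctured (half_pos (lt_min hr₁ hR))] with z hz
  have hz0 : 0 < ‖z‖ := norm_pos_iff.2 hz.1
  have hzr : 2 * ‖z‖ < r₁ := by linarith [hz.2, min_le_left r₁ R]
  have hzR : 2 * ‖z‖ < R := by linarith [hz.2, min_le_right r₁ R]
  have hb : ∀ y ∈ Metric.closedBall z (σ * ‖z‖), ‖z‖ / 2 ≤ ‖y‖ ∧ ‖y‖ ≤ 2 * ‖z‖ := fun y hy => by
    rw [Metric.mem_closedBall, dist_eq_norm] at hy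
    have h1 := norm_sub_norm_le y z
    have h2 := norm_sub_norm_le z y
    rw [norm_sub_rev] at h2
    constructor <;> nlinarith
  have hmem : ∀ y ∈ Metric.closedBall z (σ * ‖z‖),
      y ∈ Metric.ball (0 : EuclideanSpace ℝ (Fin N)) R \ {0} := fun y hy =>
    ⟨mem_ball_zero_iff.2 (by linarith [(hb y hy).2]), norm_pos_iff.1 (by linarith [(hb y hy).1])⟩
  have hconst : WeakPoisson (Metric.ball (0 : EuclideanSpace ℝ (Fin N)) R \ {0})
      (fun _ => A) (fun _ => 0) (fun _ => 0) :=
    ⟨fun x _ => hasGradientAt_const x _, continuousOn_const, continuousOn_const, by simp⟩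
  have key := (hv.sub isOpen_punctured hconst).norm_grad_le isOpen_punctured (z := z)
    (d := σ * ‖z‖) (K := 4 * K' / ‖z‖ ^ 2) (M := ε) (by positivity) hmem (fun y hy => ?_)
    (fun y hy => ?_)
  · rw [sub_zero] at key
    rw [Real.dist_eq, sub_zero, abs_of_nonneg (by positivity)]
    calc ‖z‖ * ‖p z‖ ≤ ‖z‖ * (4 * K' / ‖z‖ ^ 2 * (σ * ‖z‖) / 2 + N * ε / (σ * ‖z‖)) := by gcongr
      _ = 2 * K' * σ + N / (4 * (N + 1)) * κ := by
          rw [hε]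
          field_simp
          ring
      _ < κ := by
          have h2 : (N : ℝ) / (4 * (N + 1)) ≤ 1 / 4 := by
            rw [div_le_div_iff₀ (by positivity) (by norm_num)]
            linarith
          nlinarith
  · have h3 := hg y (hmem y hy)
    rw [sub_zero]
    refine h3.trans ?_
    have h4 := (hb y hy).1
    have hy0 : 0 < ‖y‖ := by linarith
    rw [div_le_div_iff₀ (by positivity) (by positivity)]
    have h5 : ‖z‖ ^ 2 ≤ 4 * ‖y‖ ^ 2 := by nlinarith
    have h6 : K ≤ K' := le_max_left _ _
    calc K * ‖z‖ ^ 2 ≤ K' * (4 * ‖y‖ ^ 2) := by gcongr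
      _ = 4 * K' * ‖y‖ ^ 2 := by ring
  · have h3 := h1 (y := y) (by rw [dist_zero_right]; linarith [(hb y hy).2]) (hmem y hy).2
    rw [Real.dist_eq] at h3
    exact h3.le

end Limit

section Conclusion

variable {N : ℕ} {w u : EuclideanSpace ℝ (Fin N) → ℝ}
  {p : EuclideanSpace ℝ (Fin N) → EuclideanSpace ℝ (Fin N)} {ρ lam τ θ q b m : ℝ}

/-- The equation for `w - m log ‖x‖`, when `m` is a root of the first order part, is a bounded
perturbation of a first order term in the gradient. -/
lemma abs_logRhs_sub_le (hτ0 : 0 ≤ τ) (hτ1 : τ < 1) (hm : 0 < m)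
    (hH : radialH ρ lam τ m = 0) (hbθ : θ + 2 = -((q - 1) * b)) {x : EuclideanSpace ℝ (Fin N)}
    (hx : x ≠ 0) :
    |(logRhs ρ lam τ θ q w p x - ((N : ℝ) - 2) * m / ‖x‖ ^ 2) * ‖x‖ ^ 2
        - Real.exp ((q - 1) * (w x - b * Real.log ‖x‖))|
      ≤ ‖x‖ * ‖p x - (m / ‖x‖ ^ 2) • x‖ * (‖x‖ * ‖p x - (m / ‖x‖ ^ 2) • x‖
        + (|(N : ℝ) - 2 + 2 * ρ - 2 * m| + |lam| * m ^ (-τ))) := by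
  have hr : 0 < ‖x‖ := norm_pos_iff.2 hx
  set d := p x - (m / ‖x‖ ^ 2) • x with hd
  have hp : p x = d + (m / ‖x‖ ^ 2) • x := by rw [hd]; abel
  have e1 : ⟪x, p x⟫ = m + ⟪x, d⟫ := by
    rw [hp, inner_add_right, inner_smul_right, real_inner_self_eq_norm_sq]
    field_simp
    ring
  have e0 : ‖(m / ‖x‖ ^ 2) • x‖ = m / ‖x‖ := by
    rw [norm_smul, norm_of_nonneg (by positivity)]
    field_simp
  have e2 : ‖p x‖ ^ 2 * ‖x‖ ^ 2 = (‖x‖ * ‖d‖) ^ 2 + 2 * m * ⟪x, d⟫ + m ^ 2 := by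
    rw [hp, norm_add_sq_real, inner_smul_right, e0, real_inner_comm]
    field_simp
  have e3 : ‖p x‖ ^ (1 - τ) / ‖x‖ ^ (τ + 1) * ‖x‖ ^ 2 = (‖x‖ * ‖p x‖) ^ (1 - τ) := by
    have : ‖x‖ ^ 2 = ‖x‖ ^ (1 - τ) * ‖x‖ ^ (τ + 1) := by
      rw [← rpow_add hr, show 1 - τ + (τ + 1) = (2 : ℕ) by push_cast; ring, rpow_natCast]
    rw [this, mul_rpow hr.le (norm_nonneg _)]
    field_simp
  have e4 : ‖x‖ ^ θ * Real.exp ((q - 1) * w x) * ‖x‖ ^ 2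
      = Real.exp ((q - 1) * (w x - b * Real.log ‖x‖)) := by
    rw [rpow_eq_exp_of_add_two hr hbθ, show (q - 1) * (w x - b * Real.log ‖x‖)
      = -((q - 1) * b) * Real.log ‖x‖ + (q - 1) * w x by ring, Real.exp_add]
    field_simp
  have h1 : |(‖x‖ * ‖p x‖) ^ (1 - τ) - m ^ (1 - τ)| ≤ m ^ (-τ) * (‖x‖ * ‖d‖) := by
    refine (abs_rpow_sub_rpow_le hτ0 hτ1 hm (by positivity)).trans ?_
    gcongr
    have h2 := abs_norm_sub_norm_le (p x) ((m / ‖x‖ ^ 2) • x)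
    rw [← hd, e0] at h2
    calc |‖x‖ * ‖p x‖ - m| = ‖x‖ * |‖p x‖ - m / ‖x‖| := by
          rw [← abs_of_pos hr, ← abs_mul, abs_of_pos hr, mul_sub, mul_div_cancel₀ _ hr.ne']
      _ ≤ ‖x‖ * ‖d‖ := by gcongr
  rw [radialH, abs_of_pos hm] at hH
  have e5 : (logRhs ρ lam τ θ q w p x - ((N : ℝ) - 2) * m / ‖x‖ ^ 2) * ‖x‖ ^ 2
      - Real.exp ((q - 1) * (w x - b * Real.log ‖x‖))
      = -(‖x‖ * ‖d‖) ^ 2 + ((N : ℝ) - 2 + 2 * ρ - 2 * m) * ⟪x, d⟫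
        - lam * ((‖x‖ * ‖p x‖) ^ (1 - τ) - m ^ (1 - τ)) := by
    have e6 : (logRhs ρ lam τ θ q w p x - ((N : ℝ) - 2) * m / ‖x‖ ^ 2) * ‖x‖ ^ 2
        = -(‖p x‖ ^ 2 * ‖x‖ ^ 2) + ((N : ℝ) - 2 + 2 * ρ) * ⟪x, p x⟫
          - lam * (‖p x‖ ^ (1 - τ) / ‖x‖ ^ (τ + 1) * ‖x‖ ^ 2)
          + ‖x‖ ^ θ * Real.exp ((q - 1) * w x) * ‖x‖ ^ 2 - ((N : ℝ) - 2) * m := by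
      rw [logRhs]
      field_simp
    rw [e6, e2, e3, e4, e1]
    linear_combination -hH
  rw [e5]
  have h2 : |((N : ℝ) - 2 + 2 * ρ - 2 * m) * ⟪x, d⟫|
      ≤ |(N : ℝ) - 2 + 2 * ρ - 2 * m| * (‖x‖ * ‖d‖) := by
    rw [abs_mul]
    gcongr
    exact abs_real_inner_le_norm _ _
  have h3 : |lam * ((‖x‖ * ‖p x‖) ^ (1 - τ) - m ^ (1 - τ))|
      ≤ |lam| * (m ^ (-τ) * (‖x‖ * ‖d‖)) := by
    rw [abs_mul]
    gcongr
  calc _ ≤ |-(‖x‖ * ‖d‖) ^ 2| + |((N : ℝ) - 2 + 2 * ρ - 2 * m) * ⟪x, d⟫|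
        + |lam * ((‖x‖ * ‖p x‖) ^ (1 - τ) - m ^ (1 - τ))| :=
        (abs_sub _ _).trans (by gcongr; exact abs_add_le _ _)
    _ ≤ _ := by
        rw [abs_neg, abs_of_nonneg (by positivity)]
        linarith

lemma WeakPoisson.sub_log_norm {U : Set (EuclideanSpace ℝ (Fin N))}
    {g : EuclideanSpace ℝ (Fin N) → ℝ} (hU : IsOpen U) (hU0 : ∀ x ∈ U, x ≠ 0)
    (hw : WeakPoisson U w p g) (m : ℝ) :
    WeakPoisson U (fun x => w x - m * Real.log ‖x‖) (fun x => p x - (m / ‖x‖ ^ 2) • x)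
      (fun x => g x - ((N : ℝ) - 2) * m / ‖x‖ ^ 2) := by
  obtain ⟨D, hD, htr⟩ := exists_hasHessianOn_radial (N := N) (I := Set.univ)
    (φ := fun s => m * s) (φ' := fun _ => m) (φ'' := fun _ => 0)
    (fun s _ => by simpa using (hasDerivAt_id s).const_mul m) (fun s _ => hasDerivAt_const _ _)
    continuousOn_const
  refine (hw.sub hU ((hD.weakPoisson (isOpen_radial isOpen_univ)).mono
    fun x hx => ⟨hU0 x hx, Set.mem_univ _⟩)).congr_rhs fun x hx => ?_
  rw [htr x (hU0 x hx), zero_add]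

/-- The profile of a solution at the origin, given the sign structure of the first order part. -/
theorem IsSolutionE.exists_tendsto_of_radialBounds {Ω : Set (EuclideanSpace ℝ (Fin N))} {ε h : ℝ}
    (hN : 2 ≤ N) (hΩ : IsOpen Ω) (h0 : (0 : EuclideanSpace ℝ (Fin N)) ∈ Ω)
    (hu : IsSolutionE N ρ lam τ θ q Ω u) (hτ0 : 0 ≤ τ) (hτ1 : τ < 1)
    (hq : 1 < q) (hbθ : θ + 2 = -((q - 1) * b)) (hB : RadialBounds ρ lam τ b m ε h) :
    ∃ a : ℝ, 0 < a ∧ Tendsto (fun x => ‖x‖ ^ (-m) * u x) (𝓝[≠] 0) (𝓝 a) ∧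
      Tendsto (fun x => ‖x‖ ^ (-m) * ⟪x, gradient u x⟫) (𝓝[≠] 0) (𝓝 (a * m)) := by
  have hbm := hB.b_lt
  have hm : 0 < m := hB.b_pos.trans hbm
  obtain ⟨R₀, hR₀, hR₀Ω⟩ := Metric.isOpen_iff.1 hΩ 0 h0
  set w : EuclideanSpace ℝ (Fin N) → ℝ := fun x => Real.log (u x) with hwdef
  set p : EuclideanSpace ℝ (Fin N) → EuclideanSpace ℝ (Fin N) :=
    fun x => (u x)⁻¹ • gradient u x with hpdef
  set v : EuclideanSpace ℝ (Fin N) → ℝ := fun x => w x - m * Real.log ‖x‖ with hvdef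
  have hw₀ : WeakPoisson (Metric.ball 0 R₀ \ {0}) w p (logRhs ρ lam τ θ q w p) :=
    (hu.weakPoisson_log hΩ hτ1).mono (Set.sdiff_subset_sdiff_left hR₀Ω)
  set s₀ := Real.log R₀ - 1 with hs₀
  have hs₀R : s₀ < Real.log R₀ := by linarith
  have hv₀ := hw₀.sub_log_norm isOpen_punctured (fun x hx => hx.2) m
  obtain ⟨C, hC⟩ := (isCompact_shell (N := N) s₀ s₀).exists_bound_of_continuousOn
    (hv₀.continuousOn.mono (shell_subset_punctured hR₀ hs₀R))
  have hsphere : ∀ y : EuclideanSpace ℝ (Fin N), y ≠ 0 → Real.log ‖y‖ = s₀ → |v y| ≤ C :=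
    fun y hy hys => hC y ⟨hy, hys.ge, hys.le⟩
  have hupper := sub_log_le_of_sphere hR₀ hw₀ hbθ hq hτ0 hτ1 hB hs₀R
    fun y hy hys => (abs_le.1 (hsphere y hy hys)).2
  have hδ : 0 < (q - 1) * (m - b) := mul_pos (by linarith) (by linarith)
  set L := (Real.exp ((q - 1) * C) + 1) / ((q - 1) * (m - b)) ^ 2 with hL
  have hlower := le_sub_log_of_sphere hR₀ hw₀ hbθ hq hB hs₀R le_rfl hupper (K := L)
    (by rw [hL, div_mul_cancel₀ _ (by positivity)]; linarith)
    fun y hy hys => (abs_le.1 (hsphere y hy hys)).1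
  set V := C + L * Real.exp ((q - 1) * (m - b) * s₀) with hVdef
  have hL0 : 0 < L := by positivity
  have hR₁ : 0 < Real.exp s₀ := Real.exp_pos s₀
  have hV : ∀ x ∈ Metric.ball 0 (Real.exp s₀) \ {0}, |v x| ≤ V := fun x hx => by
    have h1 := (mem_punctured_iff hR₁).1 hx
    rw [Real.log_exp] at h1
    have h2 := hupper x h1.1 h1.2.le
    have h3 := hlower x h1.1 h1.2.le
    have h4 : 0 < L * Real.exp ((q - 1) * (m - b) * s₀) := by positivity
    rw [abs_le]
    constructor <;> simp only [hvdef] <;> linarith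
  have hR₁R₀ : Real.exp s₀ ≤ R₀ := ((Real.lt_log_iff_exp_lt hR₀).1 hs₀R).le
  obtain ⟨G, hG⟩ := hu.exists_norm_mul_norm_grad_le hΩ hτ0 hτ1 hq hbθ hm hbm
    ((Metric.ball_subset_ball hR₁R₀).trans hR₀Ω) hV
  set R := Real.exp s₀ / 2 with hRdef
  have hR : 0 < R := by positivity
  have hRR₁ : R ≤ Real.exp s₀ := by linarith
  have hw : WeakPoisson (Metric.ball 0 R \ {0}) w p (logRhs ρ lam τ θ q w p) :=
    hw₀.mono (Set.sdiff_subset_sdiff_left (Metric.ball_subset_ball (hRR₁.trans hR₁R₀)))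
  have hVR : ∀ x ∈ Metric.ball 0 R \ {0}, |v x| ≤ V := fun x hx =>
    hV x (Set.sdiff_subset_sdiff_left (Metric.ball_subset_ball hRR₁) hx)
  have hv := hw.sub_log_norm isOpen_punctured (fun x hx => hx.2) m
  set P : EuclideanSpace ℝ (Fin N) → EuclideanSpace ℝ (Fin N) :=
    fun x => p x - (m / ‖x‖ ^ 2) • x with hPdef
  have hGP : ∀ x ∈ Metric.ball 0 R \ {0}, ‖x‖ * ‖P x‖ ≤ G + m := fun x hx => by
    have hr : 0 < ‖x‖ := norm_pos_iff.2 hx.2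
    have h1 := hG x hx.2 (mem_ball_zero_iff.1 hx.1)
    have h2 : ‖P x‖ ≤ ‖p x‖ + m / ‖x‖ := by
      refine (norm_sub_le _ _).trans (add_le_add_right (le_of_eq ?_) _)
      rw [norm_smul, norm_of_nonneg (by positivity)]
      field_simp
    calc ‖x‖ * ‖P x‖ ≤ ‖x‖ * (‖p x‖ + m / ‖x‖) := by gcongr
      _ = ‖x‖ * ‖p x‖ + m := by field_simp
      _ ≤ G + m := by gcongr
  set B := |(N : ℝ) - 2 + 2 * ρ - 2 * m| + |lam| * m ^ (-τ) with hBdef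
  have hB0 : 0 ≤ B := by positivity
  set g : EuclideanSpace ℝ (Fin N) → ℝ :=
    fun x => logRhs ρ lam τ θ q w p x - ((N : ℝ) - 2) * m / ‖x‖ ^ 2 with hgdef
  set K := |G + m| + B with hK
  have hK0 : 0 ≤ K := by positivity
  have hgx : ∀ x ∈ Metric.ball 0 R \ {0}, |g x * ‖x‖ ^ 2
      - Real.exp ((q - 1) * (w x - b * Real.log ‖x‖))| ≤ ‖x‖ * ‖P x‖ * K := fun x hx => by
    refine (abs_logRhs_sub_le hτ0 hτ1 hm hB.zero hbθ hx.2).trans ?_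
    refine mul_le_mul_of_nonneg_left ?_ (by positivity)
    have := (hGP x hx).trans (le_abs_self _)
    simp only [hPdef] at this
    linarith
  have hglow : ∀ x ∈ Metric.ball 0 R \ {0}, -(K / ‖x‖ * ‖P x‖) ≤ g x := fun x hx => by
    have hr : 0 < ‖x‖ := norm_pos_iff.2 hx.2
    have h1 := (abs_le.1 (hgx x hx)).1
    have h2 := Real.exp_pos ((q - 1) * (w x - b * Real.log ‖x‖))
    refine le_of_mul_le_mul_right ?_ (by positivity : 0 < ‖x‖ ^ 2)
    have e : -(K / ‖x‖ * ‖P x‖) * ‖x‖ ^ 2 = -(‖x‖ * ‖P x‖ * K) := by field_simp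
    linarith
  set E := Real.exp ((q - 1) * (V + (m - b) * Real.log R)) with hE
  have hgabs : ∀ x ∈ Metric.ball 0 R \ {0}, |g x| ≤ (|G + m| * K + E) / ‖x‖ ^ 2 := fun x hx => by
    have hr : 0 < ‖x‖ := norm_pos_iff.2 hx.2
    have h2 := Real.exp_pos ((q - 1) * (w x - b * Real.log ‖x‖))
    have h3 : Real.exp ((q - 1) * (w x - b * Real.log ‖x‖)) ≤ E := by
      rw [hE, Real.exp_le_exp]
      refine mul_le_mul_of_nonneg_left ?_ (by linarith)
      have a1 := (abs_le.1 (hVR x hx)).2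
      simp only [hvdef] at a1
      have a2 : (m - b) * Real.log ‖x‖ ≤ (m - b) * Real.log R :=
        mul_le_mul_of_nonneg_left (Real.log_le_log hr (mem_ball_zero_iff.1 hx.1).le) (by linarith)
      linarith
    have h4 : ‖x‖ * ‖P x‖ * K ≤ |G + m| * K :=
      mul_le_mul_of_nonneg_right ((hGP x hx).trans (le_abs_self _)) hK0
    rw [le_div_iff₀ (by positivity), ← abs_of_pos (by positivity : 0 < ‖x‖ ^ 2), ← abs_mul]
    have h5 := abs_le.1 (hgx x hx)
    rw [abs_le]
    constructor <;> linarith [h5.1, h5.2]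
  obtain ⟨A, hA⟩ := hv.exists_tendsto hN hR hK0 hVR hGP hglow fun s κ hs hκ =>
    sub_log_le_of_sphere hR hw hbθ hq hτ0 hτ1 hB hs hκ
  have hP := hv.tendsto_norm_mul_norm_grad hR hgabs hA
  have hexp : Tendsto (fun x => Real.exp (v x)) (𝓝[≠] 0) (𝓝 (Real.exp A)) :=
    (Real.continuous_exp.tendsto A).comp hA
  have hev : ∀ᶠ x in 𝓝[≠] (0 : EuclideanSpace ℝ (Fin N)), x ≠ 0 ∧ 0 < u x := by
    filter_upwards [eventually_punctured hR₀] with x hx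
    exact ⟨hx.1, hu.1.2 x ⟨hR₀Ω (mem_ball_zero_iff.2 hx.2), hx.1⟩⟩
  have hvu : ∀ x : EuclideanSpace ℝ (Fin N), x ≠ 0 → 0 < u x →
      Real.exp (v x) = ‖x‖ ^ (-m) * u x := fun x hx hux => by
    simp only [hvdef, hwdef]
    rw [sub_eq_neg_add, Real.exp_add, Real.exp_log hux, rpow_def_of_pos (norm_pos_iff.2 hx)]
    ring_nf
  have hinner : Tendsto (fun x => ⟪x, P x⟫) (𝓝[≠] 0) (𝓝 0) :=
    squeeze_zero_norm (fun x => norm_inner_le_norm x (P x)) hP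
  refine ⟨Real.exp A, Real.exp_pos A, hexp.congr' ?_, ?_⟩
  · filter_upwards [hev] with x hx
    exact hvu x hx.1 hx.2
  · have h1 := hexp.mul (hinner.const_add m)
    rw [add_zero] at h1
    refine h1.congr' ?_
    filter_upwards [hev] with x hx
    have hr : 0 < ‖x‖ := norm_pos_iff.2 hx.1
    have hux := hx.2
    have e : ⟪x, P x⟫ = ⟪x, gradient u x⟫ / u x - m := by
      simp only [hPdef, hpdef]
      rw [inner_sub_right, inner_smul_right, inner_smul_right, real_inner_self_eq_norm_sq]
      field_simp
    rw [hvu x hx.1 hux, e]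
    field_simp
    ring

end Conclusion

/-- If `β ∈ (ϖ₁, 0)` in Case [N₁], or `β ∈ (ϖ₁, ϖ₂]` in Case [N₂] with
`ρ > Υ`, then for every positive solution `u` of (E) in `Ω \ {0}` there exists `a > 0`
with `|x|^{ϖ₁} u(x) → a` and `|x|^{ϖ₁} (x·∇u(x)) → -a ϖ₁` as `|x| → 0`. -/
theorem stmt10_weak_singularity
    (N : ℕ) (hN : 2 ≤ N) (ρ lam τ θ q : ℝ)
    (hτ0 : 0 ≤ τ) (hτ1 : τ < 1) (hq : 1 < q)
    (Ω : Set (EuclideanSpace ℝ (Fin N))) (hΩ : IsOpen Ω) (h0 : (0 : EuclideanSpace ℝ (Fin N)) ∈ Ω)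
    (w1 : ℝ) (hw1 : IsMinNegRoot ρ lam τ w1)
    (hcase : (CaseN1 ρ lam τ ∧ w1 < (θ + 2) / (q - 1) ∧ (θ + 2) / (q - 1) < 0) ∨
      (CaseN2 ρ lam τ ∧ Upsilon lam τ < ρ ∧
        ∃ w2 : ℝ, IsMaxNegRoot ρ lam τ w2 ∧ w1 < (θ + 2) / (q - 1) ∧ (θ + 2) / (q - 1) ≤ w2))
    (u : EuclideanSpace ℝ (Fin N) → ℝ)
    (hu : IsSolutionE N ρ lam τ θ q Ω u) :
    ∃ a : ℝ, 0 < a ∧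
      Filter.Tendsto (fun x : EuclideanSpace ℝ (Fin N) => ‖x‖ ^ w1 * u x)
        (𝓝[≠] (0 : EuclideanSpace ℝ (Fin N))) (𝓝 a) ∧
      Filter.Tendsto (fun x : EuclideanSpace ℝ (Fin N) => ‖x‖ ^ w1 * ⟪x, gradient u x⟫)
        (𝓝[≠] (0 : EuclideanSpace ℝ (Fin N))) (𝓝 (-(a * w1))) := by
  have hbθ : θ + 2 = -((q - 1) * -((θ + 2) / (q - 1))) := by
    have : q - 1 ≠ 0 := by linarith
    field_simp
  have hroot := radialK_eq_zero hw1.1 hw1.2.1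
  have hbounds : ∃ ε h, RadialBounds ρ lam τ (-((θ + 2) / (q - 1))) (-w1) ε h := by
    rcases hcase with ⟨hN1, h1, h2⟩ | ⟨⟨hlam, hτ, -, -⟩, hρ, w2, hw2, h1, h2⟩
    · refine ⟨1, 1, radialBounds_of_monotone (by linarith) (by linarith) hτ0 ?_ hroot⟩
      exact hN1.elim (fun h => Or.inr h.1) fun h => Or.inl h.1.le
    · refine exists_radialBounds_of_convex (neg_pos.2 hw2.1) (by linarith) (by linarith)
        (convexOn_radialK hlam.le hτ0) (radialK_eq_zero hw2.1 hw2.2.1) hroot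
        (rpow_pos_of_pos (mul_pos hlam hτ) (1 / (τ + 1))) ?_
      rw [radialK_critical hlam hτ]
      linarith
  obtain ⟨ε, h, hB⟩ := hbounds
  simpa only [neg_neg, mul_neg] using hu.exists_tendsto_of_radialBounds hN hΩ h0 hτ0 hτ1 hq hbθ hB

end
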